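/- arXiv:2505.07092 — 2 statements merged into one kernel-verified Lean document; each statement's English description precedes it below -/
import Mathlib

section
/- Let p and q be primes with p ≡ 5 (mod 8), q ≡ 7 (mod 8) and Legendre symbol (p/q) = 1. Then the product ε_{pq}·ε_{2pq} is a square in the real biquadratic field ℚ(√2, √(pq)) (viewing the fundamental units as real numbers and ℚ(√2, √(pq)) as a subfield of ℝ). -/
open Real IntermediateField

noncomputable section

/-- `e : ℝ` is a unit greater than `1` of the ring of integers of the real quadratic
field `ℚ(√d)`: it can be written as `(x + y√d)/2` with `x, y ≥ 1` integers satisfying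
`x² - d·y² = ±4`. -/
def IsQuadUnit (d : ℕ) (e : ℝ) : Prop :=
  ∃ x y : ℤ, 1 ≤ x ∧ 1 ≤ y ∧
    (x ^ 2 - (d : ℤ) * y ^ 2 = 4 ∨ x ^ 2 - (d : ℤ) * y ^ 2 = -4) ∧
    2 * e = (x : ℝ) + (y : ℝ) * Real.sqrt d

/-- `e` is the fundamental unit of the real quadratic field `ℚ(√d)` (for `d > 1`
squarefree), i.e. the smallest unit `> 1` of its ring of integers. -/
def IsFundamentalUnit (d : ℕ) (e : ℝ) : Prop :=
  IsQuadUnit d e ∧ ∀ e' : ℝ, IsQuadUnit d e' → e ≤ e'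

/-- A prime factor of a product of coprime numbers can be pulled out of exactly one factor. -/
theorem Nat.Coprime.exists_eq_prime_mul {l x y w : ℕ} (hl : l.Prime) (hxy : x.Coprime y)
    (h : x * y = l * w) :
    (∃ x', x = l * x' ∧ x'.Coprime y ∧ x' * y = w) ∨
      (∃ y', y = l * y' ∧ x.Coprime y' ∧ x * y' = w) := by
  rcases (hl.dvd_mul).1 (h ▸ Dvd.intro w rfl : l ∣ x * y) with ⟨x', rfl⟩ | ⟨y', rfl⟩
  · exact .inl ⟨x', rfl, hxy.coprime_mul_left, Nat.eq_of_mul_eq_mul_left hl.pos (by linarith)⟩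
  · exact .inr ⟨y', rfl, hxy.coprime_mul_left_right,
      Nat.eq_of_mul_eq_mul_left hl.pos (by linarith)⟩

/-- Coprime natural numbers whose product is a square are squares. -/
theorem Nat.Coprime.exists_sq_and_sq {x y z : ℕ} (hxy : x.Coprime y) (h : x * y = z ^ 2) :
    (∃ r, x = r ^ 2) ∧ ∃ s, y = s ^ 2 :=
  ⟨exists_eq_pow_of_mul_eq_pow (Nat.isUnit_iff.2 hxy) h,
    exists_eq_pow_of_mul_eq_pow (Nat.isUnit_iff.2 hxy.symm) (by rw [mul_comm, h])⟩

/-- Coprime natural numbers whose product is twice a square are a square and twice a square. -/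
theorem Nat.Coprime.exists_sq_or_two_mul_sq {x y z : ℕ} (hxy : x.Coprime y)
    (h : x * y = 2 * z ^ 2) :
    (∃ r s, x = 2 * r ^ 2 ∧ y = s ^ 2) ∨ ∃ r s, x = r ^ 2 ∧ y = 2 * s ^ 2 := by
  rcases hxy.exists_eq_prime_mul Nat.prime_two h with ⟨w, rfl, hc, hw⟩ | ⟨w, rfl, hc, hw⟩
  · obtain ⟨⟨r, rfl⟩, s, rfl⟩ := hc.exists_sq_and_sq hw
    exact .inl ⟨r, s, rfl, rfl⟩
  · obtain ⟨⟨r, rfl⟩, s, rfl⟩ := hc.exists_sq_and_sq hw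
    exact .inr ⟨r, s, rfl, rfl⟩

theorem not_isSquare_neg_one_of_mod_eight_eq_seven {q : ℕ} [Fact q.Prime] (hq8 : q % 8 = 7) :
    ¬ IsSquare (-1 : ZMod q) := by
  rw [ZMod.exists_sq_eq_neg_one_iff]
  omega

theorem isSquare_two_of_mod_eight_eq_seven {q : ℕ} [Fact q.Prime] (hq8 : q % 8 = 7) :
    IsSquare (2 : ZMod q) := by
  rw [ZMod.exists_sq_eq_two_iff (by rintro rfl; omega)]
  omega

theorem not_isSquare_two_of_mod_eight_eq_five {p : ℕ} [Fact p.Prime] (hp8 : p % 8 = 5) :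
    ¬ IsSquare (2 : ZMod p) := by
  rw [ZMod.exists_sq_eq_two_iff (by rintro rfl; omega)]
  omega

theorem two_ne_zero_of_odd_prime {q : ℕ} [Fact q.Prime] (hq2 : q % 2 = 1) :
    (2 : ZMod q) ≠ 0 := by
  intro h
  have h' : ((2 : ℕ) : ZMod q) = 0 := by exact_mod_cast h
  rw [ZMod.natCast_eq_zero_iff] at h'
  have := Nat.le_of_dvd two_pos h'
  have := (Fact.out : q.Prime).two_le
  omega

/-- A nonzero square plus a square is nonzero when `-1` is not a square. -/
theorem add_ne_zero_of_isSquare {F : Type*} [Field F] (hF : ¬ IsSquare (-1 : F)) {y c : F}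
    (hy : IsSquare y) (hc : IsSquare c) (hc0 : c ≠ 0) : y + c ≠ 0 := by
  intro h
  apply hF
  have : (-1 : F) = y / c := by
    rw [eq_div_iff hc0]; linear_combination -h
  rw [this]
  exact hy.div hc

/-- Descent for coprime `x, y` with `x * y = δ p q z²` (`δ = 1, 2`) and `x - y` equal to `1`
or `2`: the residue conditions on `p, q` force `q ∣ y`, and either `p ∣ x` or `x` is a square. -/
theorem descent_of_coprime {p q : ℕ} [Fact p.Prime] [Fact q.Prime]
    (hp8 : p % 8 = 5) (hq8 : q % 8 = 7) (hpq : IsSquare (p : ZMod q))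
    {δ c x y z : ℕ} (hδ : (δ = 1 ∧ c = 2) ∨ ((δ = 1 ∨ δ = 2) ∧ c = 1))
    (hxy : x.Coprime y) (h : x * y = δ * (p * q) * z ^ 2) (hc : x = y + c) :
    (∃ n, x = p * n ^ 2 ∨ x = 2 * p * n ^ 2) ∨
      (c = 1 ∧ ∃ r s, x = r ^ 2 ∧ y = δ * (p * q) * s ^ 2) := by
  have hq2 := isSquare_two_of_mod_eight_eq_seven hq8
  have hq1 := not_isSquare_neg_one_of_mod_eight_eq_seven hq8
  have hp2 := not_isSquare_two_of_mod_eight_eq_five hp8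
  have hcq : IsSquare (c : ZMod q) ∧ (c : ZMod q) ≠ 0 := by
    rcases hδ with ⟨-, rfl⟩ | ⟨-, rfl⟩
    · exact ⟨by simpa using hq2, by simpa using two_ne_zero_of_odd_prime (q := q) (by omega)⟩
    · simp
  have hδ' : δ = 1 ∨ δ = 2 := by tauto
  -- The prime `q` cannot divide `x`, since `y` would then be a square modulo `q`.
  have key : ∀ x', x = q * x' → ¬ IsSquare (y : ZMod q) := by
    intro x' hx' hy
    apply add_ne_zero_of_isSquare hq1 hy hcq.1 hcq.2
    have : ((y + c : ℕ) : ZMod q) = 0 := by rw [← hc, hx']; simp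
    exact_mod_cast this
  have hxp : ∀ y', y = p * y' → (x : ZMod p) = c := by
    intro y' hy'
    rw [hc, hy']; simp
  rcases hxy.exists_eq_prime_mul (w := p * (δ * z ^ 2)) (Fact.out : q.Prime)
    (by rw [h]; ring) with ⟨x', hx', hco, h1⟩ | ⟨y', hy', hco, h1⟩
  · exfalso
    apply key x' hx'
    rcases hco.exists_eq_prime_mul (Fact.out : p.Prime) h1 with
      ⟨x'', -, hco, h2⟩ | ⟨y'', rfl, hco, h2⟩ <;>
    rcases hδ' with rfl | rfl
    · obtain ⟨-, s, rfl⟩ := hco.exists_sq_and_sq (by simpa using h2)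
      simpa using IsSquare.sq _
    · obtain ⟨r, s, -, rfl⟩ | ⟨r, s, -, rfl⟩ := hco.exists_sq_or_two_mul_sq h2
      · simpa using IsSquare.sq _
      · simpa using hq2.mul (IsSquare.sq _)
    · obtain ⟨-, s, rfl⟩ := hco.exists_sq_and_sq (by simpa using h2)
      simpa using hpq.mul (IsSquare.sq _)
    · obtain ⟨r, s, -, rfl⟩ | ⟨r, s, -, rfl⟩ := hco.exists_sq_or_two_mul_sq h2
      · simpa using hpq.mul (IsSquare.sq _)
      · simpa using hpq.mul (hq2.mul (IsSquare.sq _))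
  · rcases hco.exists_eq_prime_mul (Fact.out : p.Prime) h1 with
      ⟨x'', hx'', hco, h2⟩ | ⟨y'', hy'', hco, h2⟩
    · left
      rcases hδ' with rfl | rfl
      · obtain ⟨⟨r, rfl⟩, -⟩ := hco.exists_sq_and_sq (by simpa using h2)
        exact ⟨r, .inl hx''⟩
      · obtain ⟨r, s, rfl, -⟩ | ⟨r, s, rfl, -⟩ := hco.exists_sq_or_two_mul_sq h2
        · exact ⟨r, .inr (by rw [hx'']; ring)⟩
        · exact ⟨r, .inl hx''⟩
    · right
      have hxc := hxp (q * y'') (by rw [hy', hy'']; ring)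
      rcases hδ with ⟨rfl, rfl⟩ | ⟨rfl | rfl, rfl⟩
      · obtain ⟨⟨r, rfl⟩, -⟩ := hco.exists_sq_and_sq (by simpa using h2)
        refine absurd ?_ hp2
        rw [show (2 : ZMod p) = (r : ZMod p) ^ 2 by simpa using hxc.symm]
        exact IsSquare.sq _
      · obtain ⟨⟨r, hr⟩, s, hs⟩ := hco.exists_sq_and_sq (by simpa using h2)
        exact ⟨rfl, r, s, hr, by rw [hy', hy'', hs]; ring⟩
      · obtain ⟨r, s, rfl, -⟩ | ⟨r, s, hr, hs⟩ := hco.exists_sq_or_two_mul_sq h2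
        · refine absurd ?_ hp2
          have h2r : (2 : ZMod p) * r ^ 2 = 1 := by simpa using hxc
          exact ⟨2 * r, by linear_combination (-2) * h2r⟩
        · exact ⟨rfl, r, s, hr, by rw [hy', hy'', hs]; ring⟩

/-- For `d ≡ 3, 6 (mod 8)`, solutions of `x² - d y² = 4` are even. -/
theorem even_and_even_of_sq_sub_eq_four {d : ℕ} (hd : d % 8 = 3 ∨ d % 8 = 6) {x y : ℤ}
    (h : x ^ 2 - d * y ^ 2 = 4) : 2 ∣ x ∧ 2 ∣ y := by
  have hcast : ∀ t : ℤ, (2 : ℤ) ∣ t ↔ ((t : ℤ) : ZMod 8) * 4 = 0 := by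
    intro t
    rw [show ((t : ℤ) : ZMod 8) * 4 = ((t * 4 : ℤ) : ZMod 8) by push_cast; rfl,
      ZMod.intCast_zmod_eq_zero_iff_dvd _ 8]
    omega
  have h8 : (x : ZMod 8) ^ 2 - (d : ZMod 8) * (y : ZMod 8) ^ 2 = 4 := by
    exact_mod_cast congrArg (Int.cast : ℤ → ZMod 8) h
  rw [hcast, hcast]
  have hd8 : (d : ZMod 8) = 3 ∨ (d : ZMod 8) = 6 := by
    rw [← ZMod.natCast_mod d 8]
    rcases hd with hd | hd <;> rw [hd] <;> decide
  generalize (x : ZMod 8) = X at *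
  generalize (y : ZMod 8) = Y at *
  rcases hd8 with hd8 | hd8 <;> rw [hd8] at h8 <;> revert X Y <;> decide

/-- For `d ≡ 3, 6 (mod 8)` and `a² = d b² + 1`: if `a` is odd then `b` is even, and if `a` is
even then `d` is odd. -/
theorem parity_of_sq_eq_mul_sq_add_one {d a b : ℕ} (hd : d % 8 = 3 ∨ d % 8 = 6)
    (h : a ^ 2 = d * b ^ 2 + 1) : (a % 2 = 1 ∧ b % 2 = 0) ∨ (a % 2 = 0 ∧ d % 8 = 3) := by
  have h8 : a ^ 2 % 8 = (d * b ^ 2 + 1) % 8 := by rw [h]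
  have ha : a % 8 < 8 := Nat.mod_lt _ (by norm_num)
  have hb : b % 8 < 8 := Nat.mod_lt _ (by norm_num)
  rw [← Nat.mod_mod_of_dvd a (by norm_num : 2 ∣ 8), ← Nat.mod_mod_of_dvd b (by norm_num : 2 ∣ 8)]
  rw [Nat.pow_mod, Nat.add_mod, Nat.mul_mod, Nat.pow_mod b] at h8
  generalize a % 8 = A at *
  generalize b % 8 = B at *
  rcases hd with hd | hd <;> rw [hd] at h8 ⊢ <;> interval_cases A <;> interval_cases B <;>
    simp_all

/-- The trace condition on the fundamental unit `a + b√d` for `d = pq` or `d = 2pq`: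
`a + 1` is a square times `p` or `2p`. -/
theorem IsFundamentalUnit.exists_add_one_eq {p q : ℕ} [Fact p.Prime] [Fact q.Prime]
    (hp8 : p % 8 = 5) (hq8 : q % 8 = 7) (hpq : IsSquare (p : ZMod q)) {δ : ℕ}
    (hδ : δ = 1 ∨ δ = 2) {e : ℝ} (he : IsFundamentalUnit (δ * (p * q)) e) :
    ∃ a b : ℕ, e = a + b * √((δ * (p * q) : ℕ) : ℝ) ∧ a ^ 2 = δ * (p * q) * b ^ 2 + 1 ∧
      ∃ n, a + 1 = p * n ^ 2 ∨ a + 1 = 2 * p * n ^ 2 := by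
  obtain ⟨⟨x, y, hx, hy, hxy, hE⟩, hmin⟩ := he
  have hpq8 : p * q % 8 = 3 := by rw [Nat.mul_mod, hp8, hq8]
  set d := δ * (p * q) with hd
  have hd8 : d % 8 = 3 ∨ d % 8 = 6 := by rcases hδ with rfl | rfl <;> omega
  have hxy4 : x ^ 2 - (d : ℤ) * y ^ 2 = 4 := by
    rcases hxy with h | h
    · exact h
    · exfalso
      have hz := congrArg (Int.cast : ℤ → ZMod q) h
      have h2 := two_ne_zero_of_odd_prime (q := q) (by omega)
      refine add_ne_zero_of_isSquare (not_isSquare_neg_one_of_mod_eight_eq_seven hq8)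
        (IsSquare.sq (x : ZMod q)) (IsSquare.sq (2 : ZMod q)) (pow_ne_zero 2 h2) ?_
      simp only [hd] at hz
      push_cast at hz
      rw [ZMod.natCast_self] at hz
      linear_combination hz
  obtain ⟨⟨a, rfl⟩, b, rfl⟩ := even_and_even_of_sq_sub_eq_four hd8 hxy4
  lift a to ℕ using by omega
  lift b to ℕ using by omega
  have hab : a ^ 2 = d * b ^ 2 + 1 := by zify; linarith
  have hab' : e = a + b * √(d : ℝ) := by push_cast at hE; linarith
  have ha : 0 < a := by omega
  have hb : 0 < b := by omega
  refine ⟨a, b, hab', hab, ?_⟩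
  rcases parity_of_sq_eq_mul_sq_add_one hd8 hab with ⟨ha2, hb2⟩ | ⟨ha2, hd3⟩
  · obtain ⟨k, rfl⟩ : ∃ k, a = 2 * k + 1 := ⟨a / 2, by omega⟩
    obtain ⟨c, rfl⟩ : ∃ c, b = 2 * c := ⟨b / 2, by omega⟩
    have hk : (k + 1) * k = d * c ^ 2 := by nlinarith
    rcases descent_of_coprime hp8 hq8 hpq (.inr ⟨hδ, rfl⟩) (by simp) hk rfl with
      ⟨n, hn | hn⟩ | ⟨-, r, s, hr, hs⟩
    · exact ⟨n, .inr (by linarith)⟩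
    · exact ⟨2 * n, .inl (by linarith)⟩
    · exfalso
      rw [← hd] at hs
      have hk0 : 0 < k := by
        rcases Nat.eq_zero_or_pos k with rfl | h
        · have : 0 < d * c ^ 2 := Nat.mul_pos (by omega) (pow_pos (by omega) 2)
          omega
        · exact h
      have hs0 : 0 < s := by
        rcases Nat.eq_zero_or_pos s with rfl | h
        · simp at hs; omega
        · exact h
      have hr0 : 0 < r := by
        rcases Nat.eq_zero_or_pos r with rfl | h
        · simp at hr
        · exact h
      have hrk : r < 2 * k + 1 := by nlinarith
      have hsc : s ≤ 2 * c := by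
        have hd0 : 0 < d := by omega
        have : d * s ^ 2 ≤ d * (2 * c) ^ 2 := by nlinarith
        exact (Nat.pow_le_pow_iff_left two_ne_zero).1 (Nat.le_of_mul_le_mul_left this hd0)
      have hle := hmin (r + s * √(d : ℝ)) ⟨2 * r, 2 * s, by omega, by omega,
        .inl (by rw [hs] at hr; zify at hr; linear_combination (-4) * hr),
        by push_cast; ring⟩
      rw [hab'] at hle
      have h1 : (r : ℝ) < ((2 * k + 1 : ℕ) : ℝ) := by exact_mod_cast hrk
      have h2 : (s : ℝ) * √(d : ℝ) ≤ ((2 * c : ℕ) : ℝ) * √(d : ℝ) := by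
        gcongr
      linarith
  · have hδ1 : δ = 1 := by
      rcases hδ with h | rfl
      · exact h
      · omega
    obtain ⟨k, rfl⟩ : ∃ k, a = k + 1 := ⟨a - 1, by omega⟩
    have hk : (k + 2) * k = d * b ^ 2 := by linarith
    have hco : (k + 2).Coprime k := by
      rw [Nat.coprime_self_add_left, Nat.coprime_two_left, Nat.odd_iff]
      omega
    rcases descent_of_coprime hp8 hq8 hpq (.inl ⟨hδ1, rfl⟩) hco hk rfl with
      ⟨n, hn⟩ | ⟨h, -⟩
    · exact ⟨n, hn⟩
    · omega

/-- `(1 + e)² = 2 (a + 1) e` for a unit `e = a + b√d` of norm `1`. -/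
theorem one_add_sq_eq_of_norm_eq_one {a b d : ℕ} (h : a ^ 2 = d * b ^ 2 + 1) :
    (1 + (a + b * √(d : ℝ))) ^ 2 = 2 * ((a + 1 : ℕ) : ℝ) * (a + b * √(d : ℝ)) := by
  have hR : (a : ℝ) ^ 2 = d * b ^ 2 + 1 := by exact_mod_cast h
  have hs : √(d : ℝ) ^ 2 = d := Real.sq_sqrt (by positivity)
  push_cast
  linear_combination (b : ℝ) ^ 2 * hs - hR

/-- Let `p ≡ 5 (mod 8)` and `q ≡ 7 (mod 8)` be primes with Legendre symbol `(p/q) = 1`.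
Then the product `ε_{pq}·ε_{2pq}` of fundamental units is a square in the real
biquadratic field `ℚ(√2, √(pq))` (viewed inside `ℝ`). -/
theorem statement_9 (p q : ℕ) (hp : p.Prime) (hq : q.Prime)
    (hp8 : p % 8 = 5) (hq8 : q % 8 = 7)
    (hleg : @legendreSym q ⟨hq⟩ (p : ℤ) = 1)
    (epq e2pq : ℝ)
    (hepq : IsFundamentalUnit (p * q) epq)
    (he2pq : IsFundamentalUnit (2 * p * q) e2pq) :
    ∃ ξ : ℝ, ξ ∈ (adjoin ℚ {Real.sqrt 2, Real.sqrt (p * q)} : IntermediateField ℚ ℝ) ∧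
      ξ ^ 2 = epq * e2pq := by
  have : Fact p.Prime := ⟨hp⟩
  have : Fact q.Prime := ⟨hq⟩
  have hpq : IsSquare (p : ZMod q) := by
    have h0 : ((p : ℤ) : ZMod q) ≠ 0 := by
      intro h0
      rw [(legendreSym.eq_zero_iff q p).2 h0] at hleg
      exact zero_ne_one hleg
    simpa using (legendreSym.eq_one_iff q h0).1 hleg
  obtain ⟨a, b, he1, hab, n, hn⟩ := IsFundamentalUnit.exists_add_one_eq hp8 hq8 hpq (.inl rfl)
    (by simpa using hepq)
  obtain ⟨c, f, he2, hcf, m, hm⟩ := IsFundamentalUnit.exists_add_one_eq hp8 hq8 hpq (.inr rfl)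
    (by rwa [mul_assoc] at he2pq)
  have h1 := one_add_sq_eq_of_norm_eq_one hab
  have h2 := one_add_sq_eq_of_norm_eq_one hcf
  rw [← he1] at h1
  rw [← he2] at h2
  set K := (adjoin ℚ {√2, √((p : ℝ) * q)} : IntermediateField ℚ ℝ)
  have hs2 : √2 ∈ K := subset_adjoin _ _ (by simp)
  have hspq : √((p : ℝ) * q) ∈ K := subset_adjoin _ _ (by simp)
  have hnat : ∀ t : ℕ, (t : ℝ) ∈ K := fun t => _root_.natCast_mem K t
  have hK1 : epq ∈ K := by
    rw [he1]
    push_cast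
    rw [one_mul]
    exact add_mem (hnat _) (mul_mem (hnat _) hspq)
  have hK2 : e2pq ∈ K := by
    rw [he2]
    push_cast
    rw [Real.sqrt_mul zero_le_two]
    exact add_mem (hnat _) (mul_mem (hnat _) (mul_mem hs2 hspq))
  have hsq2 : √2 ^ 2 = (2 : ℝ) := Real.sq_sqrt zero_le_two
  obtain ⟨N, hNK, hN⟩ : ∃ N ∈ K, N ^ 2 = ((a + 1 : ℕ) : ℝ) * ((c + 1 : ℕ) : ℝ) := by
    have hM : (p : ℝ) * n * m ∈ K := mul_mem (mul_mem (hnat _) (hnat _)) (hnat _)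
    rcases hn with hn | hn <;> rcases hm with hm | hm <;> rw [hn, hm] <;> push_cast
    · exact ⟨p * n * m, hM, by ring⟩
    · exact ⟨√2 * (p * n * m), mul_mem hs2 hM, by rw [mul_pow, hsq2]; ring⟩
    · exact ⟨√2 * (p * n * m), mul_mem hs2 hM, by rw [mul_pow, hsq2]; ring⟩
    · exact ⟨2 * (p * n * m), mul_mem (by simp) hM, by ring⟩
  have hN0 : N ≠ 0 := by
    rintro rfl
    have : (0 : ℝ) < ((a + 1 : ℕ) : ℝ) * ((c + 1 : ℕ) : ℝ) := by positivity
    rw [← hN] at this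
    simp at this
  refine ⟨(1 + epq) * (1 + e2pq) / (2 * N), div_mem (mul_mem (add_mem (one_mem _) hK1)
    (add_mem (one_mem _) hK2)) (mul_mem (by simp) hNK), ?_⟩
  rw [div_pow, mul_pow, h1, h2, div_eq_iff (by positivity), mul_pow, hN]
  ring
end
end

section
/- Let p, q, s be distinct primes with p ≡ 5 (mod 8), s ≡ 3 (mod 8), q ≡ 7 (mod 8), and Legendre symbols (p/q) = (p/s) = (s/q) = 1. Then the subgroup of the unit group of the ring of integers of L⁺ generated by the units of the rings of integers of its seven quadratic subfields ℚ(√2), ℚ(√(pq)), ℚ(√(ps)), ℚ(√(qs)), ℚ(√(2pq)), ℚ(√(2ps)), ℚ(√(2qs)) (viewed inside L⁺) has index 2⁶ = 64. -/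
open Real NumberField IntermediateField

noncomputable section

/-- The totally real multiquadratic field `L⁺ = ℚ(√2, √(pq), √(ps))`, realized as a
subfield of `ℝ`. -/
def Lplus (p q s : ℕ) : IntermediateField ℚ ℝ :=
  adjoin ℚ {Real.sqrt 2, Real.sqrt (p * q), Real.sqrt (p * s)}

/-- The subgroup of the unit group of the ring of integers of `L⁺` generated by the
units lying in one of the seven quadratic subfields
`ℚ(√2), ℚ(√(pq)), ℚ(√(ps)), ℚ(√(qs)), ℚ(√(2pq)), ℚ(√(2ps)), ℚ(√(2qs))`. -/
def quadUnitsSubgroup (p q s : ℕ) : Subgroup (𝓞 ↥(Lplus p q s))ˣ :=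
  Subgroup.closure {u : (𝓞 ↥(Lplus p q s))ˣ |
    ∃ d ∈ ({2, p * q, p * s, q * s, 2 * p * q, 2 * p * s, 2 * q * s} : Set ℕ),
      (((u : 𝓞 ↥(Lplus p q s)) : ↥(Lplus p q s)) : ℝ) ∈
        (adjoin ℚ {Real.sqrt d} : IntermediateField ℚ ℝ)}

section SignedMonomials

/-- The sign by which the automorphism with signs `v` on `√2, √p, √q, √s` acts on `√d`, where
`d` runs through `2, pq, ps, qs, 2pq, 2ps, 2qs`. -/
def radicandSign (v : Fin 4 → ℤˣ) : Fin 7 → ℤˣ :=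
  ![v 0, v 1 * v 2, v 1 * v 3, v 2 * v 3, v 0 * v 1 * v 2, v 0 * v 1 * v 3, v 0 * v 2 * v 3]

/-- The sign by which the automorphism with signs `v` on `√2, √p, √q, √s` acts on `√m`, where
`m` runs through `2, p, p, s, 2p, s, 2s`. -/
def factorSign (v : Fin 4 → ℤˣ) : Fin 7 → ℤˣ :=
  ![v 0, v 1, v 1, v 3, v 0 * v 1, v 3, v 0 * v 3]

/-- The signs of the automorphism fixing `√2` and negating `√p, √q, √s`. -/
def oddSigns : Fin 4 → ℤˣ := ![1, -1, -1, -1]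

variable {M : Type*} [Field M]

/-- The monomial with exponents `b` in the `η i`. -/
def monomialZ (η : Fin 7 → M) (b : Fin 7 → ℤ) : M := ∏ i, η i ^ b i

lemma monomialZ_add {η : Fin 7 → M} (hη : ∀ i, η i ≠ 0) (b c : Fin 7 → ℤ) :
    monomialZ η (b + c) = monomialZ η b * monomialZ η c := by
  simp only [monomialZ, ← Finset.prod_mul_distrib, Pi.add_apply]
  exact Finset.prod_congr rfl fun i _ => zpow_add₀ (hη i) _ _

lemma monomialZ_neg (η : Fin 7 → M) (b : Fin 7 → ℤ) :
    monomialZ η (-b) = (monomialZ η b)⁻¹ := by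
  simp [monomialZ]

lemma monomialZ_two_smul (η : Fin 7 → M) (b : Fin 7 → ℤ) :
    monomialZ η (fun i => 2 * b i) = monomialZ η b ^ 2 := by
  simp only [monomialZ, ← Finset.prod_pow]
  exact Finset.prod_congr rfl fun i _ => by rw [mul_comm, zpow_mul]; norm_cast

/-- The sign picked up by the monomial with exponents `b` under the automorphism with signs `v`. -/
def monomialSign (v : Fin 4 → ℤˣ) (b : Fin 7 → ℤ) : ℤˣ := ∏ i, factorSign v i ^ b i

/-- The automorphisms `g v` act on the `η i` by signs and inversions. -/
def ActsBySigns (g : (Fin 4 → ℤˣ) → (M ≃+* M)) (η : Fin 7 → M) : Prop :=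
  ∀ v i, g v (η i) = ((factorSign v i : ℤ) : M) * η i ^ (radicandSign v i : ℤ)

variable {g : (Fin 4 → ℤˣ) → (M ≃+* M)} {η : Fin 7 → M}

lemma ActsBySigns.apply_monomialZ (h : ActsBySigns g η) (v : Fin 4 → ℤˣ) (b : Fin 7 → ℤ) :
    g v (monomialZ η b) =
      ((monomialSign v b : ℤ) : M) * monomialZ η (fun i => radicandSign v i * b i) := by
  simp only [monomialZ, monomialSign, map_prod, map_zpow₀, h v, mul_zpow, ← zpow_mul,
    Finset.prod_mul_distrib]
  congr 1
  push_cast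
  refine Finset.prod_congr rfl fun i _ => ?_
  rcases Int.units_eq_one_or (factorSign v i) with h | h <;> rw [h]
  · simp
  · rcases Int.even_or_odd (b i) with hb | hb
    · simp [hb.neg_one_zpow]
    · simp [hb.neg_one_zpow]

/-- Restriction of an exponent vector to the indices whose radicand is fixed by `v`. -/
def fixedPart (v : Fin 4 → ℤˣ) (b : Fin 7 → ℤ) : Fin 7 → ℤ :=
  fun i => if radicandSign v i = 1 then b i else 0

lemma ActsBySigns.mul_apply_monomialZ (h : ActsBySigns g η) (hη : ∀ i, η i ≠ 0)
    (v : Fin 4 → ℤˣ) (b : Fin 7 → ℤ) :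
    monomialZ η b * g v (monomialZ η b) =
      ((monomialSign v b : ℤ) : M) * monomialZ η (fixedPart v b) ^ 2 := by
  rw [h.apply_monomialZ, mul_left_comm, ← monomialZ_add hη, ← monomialZ_two_smul]
  congr 2
  funext i
  rcases Int.units_eq_one_or (radicandSign v i) with h | h <;> simp [fixedPart, h, two_mul]

lemma ActsBySigns.oddSigns_apply_monomialZ (h : ActsBySigns g η) (b : Fin 7 → ℤ) :
    g oddSigns (monomialZ η b) =
      (((-1 : ℤˣ) ^ (b 1 + b 2 + b 3 + b 4 + b 5 + b 6) : ℤˣ) : ℤ) * monomialZ η b := by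
  rw [h.apply_monomialZ]
  congr 2
  · simp [monomialSign, factorSign, oddSigns, Fin.prod_univ_succ, zpow_add, mul_assoc]
  · funext i
    fin_cases i <;> simp [radicandSign, oddSigns]

variable [LinearOrder M] [IsStrictOrderedRing M]

lemma monomialZ_pos (hη : ∀ i, 1 < η i) (b : Fin 7 → ℤ) : 0 < monomialZ η b :=
  Finset.prod_pos fun i _ => zpow_pos (zero_lt_one.trans (hη i)) _

lemma Int.units_eq_one_of_sq_eq {s : ℤˣ} {x y : M} (hy : 0 < y)
    (h : x ^ 2 = ((s : ℤ) : M) * y) : s = 1 := by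
  rcases Int.units_eq_one_or s with rfl | rfl
  · rfl
  · have := sq_nonneg x
    simp at h
    linarith

lemma ActsBySigns.even_of_fixed (h : ActsBySigns g η) (hη : ∀ i, 1 < η i) {b : Fin 7 → ℤ} {u : M}
    (hu : g oddSigns u = u) (hub : u = monomialZ η b ∨ u = - monomialZ η b) :
    Even (b 1 + b 2 + b 3 + b 4 + b 5 + b 6) := by
  have hm : g oddSigns (monomialZ η b) = monomialZ η b := by
    rcases hub with rfl | rfl
    · exact hu
    · simpa using hu
  rw [h.oddSigns_apply_monomialZ] at hm
  rcases Int.even_or_odd (b 1 + b 2 + b 3 + b 4 + b 5 + b 6) with hb | hb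
  · exact hb
  · have := monomialZ_pos hη b
    rw [hb.neg_one_zpow] at hm
    simp at hm
    linarith

/-- If `η ^ b` is the square of an element of the fixed field of `g oddSigns`, then every `v`
yields two parity conditions on `b`. -/
lemma ActsBySigns.sign_and_parity (h : ActsBySigns g η) (hη : ∀ i, 1 < η i)
    (hcomm : ∀ v w x, g v (g w x) = g w (g v x)) {b : Fin 7 → ℤ} {u : M}
    (hu : g oddSigns u = u) (hub : u ^ 2 = monomialZ η b) (v : Fin 4 → ℤˣ) :
    monomialSign v b = 1 ∧ (u * g v u = monomialZ η (fixedPart v b) ∨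
      u * g v u = - monomialZ η (fixedPart v b)) ∧
    Even (fixedPart v b 1 + fixedPart v b 2 + fixedPart v b 3 + fixedPart v b 4 +
      fixedPart v b 5 + fixedPart v b 6) := by
  have hη0 : ∀ i, η i ≠ 0 := fun i => (zero_lt_one.trans (hη i)).ne'
  have hsq : (u * g v u) ^ 2 =
      ((monomialSign v b : ℤ) : M) * monomialZ η (fixedPart v b) ^ 2 := by
    rw [← h.mul_apply_monomialZ hη0, ← hub, map_pow, mul_pow]
  have hs := Int.units_eq_one_of_sq_eq (pow_pos (monomialZ_pos hη _) 2) hsq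
  rw [hs, Units.val_one, Int.cast_one, one_mul] at hsq
  have hor := sq_eq_sq_iff_eq_or_eq_neg.1 hsq
  refine ⟨hs, hor, h.even_of_fixed hη (u := u * g v u) ?_ hor⟩
  rw [map_mul, hcomm, hu]

/-- The exponent vectors of monomials which are squares in the fixed field of `g oddSigns`. -/
lemma ActsBySigns.parities_of_sq (h : ActsBySigns g η) (hη : ∀ i, 1 < η i)
    (hcomm : ∀ v w x, g v (g w x) = g w (g v x)) {b : Fin 7 → ℤ} {u : M}
    (hu : g oddSigns u = u) (hub : u ^ 2 = monomialZ η b)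
    (hb : Even (b 1 + b 2 + b 3 + b 4 + b 5 + b 6)) :
    Even (b 0) ∧ Even (b 2) ∧ Even (b 5) ∧ Even (b 1 + b 3) ∧ Even (b 1 + b 4) ∧
      Even (b 1 + b 6) := by
  have key : ∀ n : ℤ, (-1 : ℤˣ) ^ n = 1 → Even n := fun n hn => by
    rcases Int.even_or_odd n with h | h
    · exact h
    · rw [h.neg_one_zpow] at hn
      exact absurd hn (by decide)
  obtain ⟨h1, -, h2⟩ := h.sign_and_parity hη hcomm hu hub ![-1, 1, 1, 1]
  obtain ⟨h3, -, h4⟩ := h.sign_and_parity hη hcomm hu hub ![1, -1, 1, 1]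
  obtain ⟨-, -, h6⟩ := h.sign_and_parity hη hcomm hu hub ![1, 1, -1, 1]
  simp [fixedPart, radicandSign, show ((-1 : ℤˣ) = 1) = False by decide] at h2 h4 h6
  simp [monomialSign, factorSign, Fin.prod_univ_succ, ← zpow_add] at h1 h3
  have h1 := key _ h1
  have h3 := key _ h3
  simp only [Int.even_iff] at *
  omega

lemma ActsBySigns.monomialZ_injective (h : ActsBySigns g η) (hη : ∀ i, 1 < η i) {b : Fin 7 → ℤ}
    (hb : monomialZ η b = 1) : b = 0 := by
  have hη0 : ∀ i, η i ≠ 0 := fun i => (zero_lt_one.trans (hη i)).ne'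
  have step : ∀ c : Fin 7 → ℤ, monomialZ η c = 1 → ∀ v, monomialZ η (fixedPart v c) = 1 := by
    intro c hc v
    have h1 := h.mul_apply_monomialZ hη0 v c
    rw [hc, map_one, mul_one] at h1
    have hs : monomialSign v c = 1 :=
      Int.units_eq_one_of_sq_eq (x := 1) (pow_pos (monomialZ_pos hη (fixedPart v c)) 2)
        (by rw [← h1, one_pow])
    rw [hs] at h1
    exact (pow_eq_one_iff_of_nonneg (monomialZ_pos hη _).le two_ne_zero).1 (by simpa using h1.symm)
  have single : ∀ i (v w : Fin 4 → ℤˣ),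
      (∀ j, (radicandSign w j = 1 ∧ radicandSign v j = 1) ↔ j = i) → b i = 0 := by
    intro i v w hvw
    have h1 := step _ (step b hb v) w
    rw [monomialZ, Finset.prod_eq_single i] at h1
    · have h2 := (hvw i).2 rfl
      simp only [fixedPart, h2.1, h2.2, if_true] at h1
      exact (zpow_eq_one_iff_right₀ (zero_lt_one.trans (hη i)).le (hη i).ne').1 h1
    · intro j _ hj
      have h2 := mt (hvw j).1 hj
      simp only [fixedPart]
      split_ifs with h3 h4
      · exact absurd ⟨h3, h4⟩ h2
      · simp
      · simp
    · simp
  funext i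
  fin_cases i
  · exact single 0 ![1, -1, 1, 1] ![1, 1, -1, 1] (by decide)
  · exact single 1 ![-1, 1, 1, 1] ![1, 1, 1, -1] (by decide)
  · exact single 2 ![-1, 1, 1, 1] ![1, 1, -1, 1] (by decide)
  · exact single 3 ![-1, 1, 1, 1] ![1, -1, 1, 1] (by decide)
  · exact single 4 ![-1, -1, 1, 1] ![1, 1, 1, -1] (by decide)
  · exact single 5 ![-1, -1, 1, 1] ![1, 1, -1, 1] (by decide)
  · exact single 6 ![-1, 1, -1, 1] ![1, -1, 1, 1] (by decide)

end SignedMonomials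

section LatticeIndex

/-- The parities of the last six exponents. -/
def tailParity : ℤˣ × Multiplicative (Fin 7 → ℤ) →* Multiplicative (Fin 6 → ZMod 2) :=
  (AddMonoidHom.toMultiplicative
    { toFun := fun b (i : Fin 6) => ((b i.succ : ℤ) : ZMod 2)
      map_zero' := by ext; simp
      map_add' := fun b c => by ext; simp }).comp (MonoidHom.snd _ _)

/-- The parity of the sum of the last six exponents. -/
def tailSumParity : ℤˣ × Multiplicative (Fin 7 → ℤ) →* Multiplicative (ZMod 2) :=
  (AddMonoidHom.toMultiplicative
    { toFun := fun b => ((b 1 + b 2 + b 3 + b 4 + b 5 + b 6 : ℤ) : ZMod 2)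
      map_zero' := by simp
      map_add' := fun b c => by simp only [Pi.add_apply]; push_cast; ring }).comp
    (MonoidHom.snd _ _)

lemma mem_ker_tailParity {x : ℤˣ × Multiplicative (Fin 7 → ℤ)} :
    x ∈ tailParity.ker ↔ ∀ i : Fin 6, Even (x.2.toAdd i.succ) := by
  rw [MonoidHom.mem_ker]
  change (fun i : Fin 6 => ((x.2.toAdd i.succ : ℤ) : ZMod 2)) = 0 ↔ _
  simp only [funext_iff, Pi.zero_apply, ZMod.intCast_zmod_eq_zero_iff_dvd, even_iff_two_dvd]
  rfl

lemma mem_ker_tailSumParity {x : ℤˣ × Multiplicative (Fin 7 → ℤ)} :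
    x ∈ tailSumParity.ker ↔ Even (x.2.toAdd 1 + x.2.toAdd 2 + x.2.toAdd 3 + x.2.toAdd 4 +
      x.2.toAdd 5 + x.2.toAdd 6) := by
  rw [MonoidHom.mem_ker, even_iff_two_dvd]
  exact ZMod.intCast_zmod_eq_zero_iff_dvd _ 2

lemma relIndex_ker_tailParity : tailParity.ker.relIndex tailSumParity.ker = 32 := by
  have h1 : tailParity.ker.index = 64 := by
    rw [Subgroup.index_ker, MonoidHom.range_eq_top.2]
    · simp
    · intro y
      refine ⟨(1, Multiplicative.ofAdd (Fin.cons 0 fun i => ((y.toAdd i).val : ℤ))), ?_⟩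
      change (fun i : Fin 6 => (((Fin.cons 0 fun i => ((y.toAdd i).val : ℤ) : Fin 7 → ℤ) i.succ : ℤ)
        : ZMod 2)) = y.toAdd
      funext i
      simp
  have h2 : tailSumParity.ker.index = 2 := by
    rw [Subgroup.index_ker, MonoidHom.range_eq_top.2]
    · simp
    · intro y
      let b : Fin 7 → ℤ := Pi.single 1 ((y.toAdd).val : ℤ)
      refine ⟨(1, Multiplicative.ofAdd b), ?_⟩
      change ((b 1 + b 2 + b 3 + b 4 + b 5 + b 6 : ℤ) : ZMod 2) = y.toAdd
      simp [b]
  have hle : tailParity.ker ≤ tailSumParity.ker := by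
    intro x hx
    rw [mem_ker_tailParity] at hx
    rw [mem_ker_tailSumParity]
    exact ((((hx 0).add (hx 1)).add (hx 2)).add (hx 3)).add (hx 4) |>.add (hx 5)
  have := Subgroup.relIndex_mul_index hle
  rw [h1, h2] at this
  omega

variable {M : Type*} [Field M]

/-- Signed monomials as a homomorphism to the units of the field. -/
def signedMonomial (η : Fin 7 → M) (hη : ∀ i, η i ≠ 0) :
    ℤˣ × Multiplicative (Fin 7 → ℤ) →* Mˣ :=
  (Units.map (Int.castRingHom M).toMonoidHom).coprod
    (MonoidHom.mk' (fun b => Units.mk0 (monomialZ η b.toAdd)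
      (Finset.prod_ne_zero_iff.2 fun i _ => zpow_ne_zero _ (hη i)))
      fun b c => Units.ext (monomialZ_add hη b.toAdd c.toAdd))

lemma signedMonomial_apply (η : Fin 7 → M) (hη : ∀ i, η i ≠ 0)
    (x : ℤˣ × Multiplicative (Fin 7 → ℤ)) :
    (signedMonomial η hη x : M) = ((x.1 : ℤ) : M) * monomialZ η x.2.toAdd := rfl

lemma mem_map_signedMonomial (η : Fin 7 → M) (hη : ∀ i, η i ≠ 0) (P : (Fin 7 → ℤ) → Prop)
    (H : Subgroup (ℤˣ × Multiplicative (Fin 7 → ℤ))) (hH : ∀ x, x ∈ H ↔ P x.2.toAdd) (u : Mˣ) :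
    u ∈ H.map (signedMonomial η hη) ↔
      ∃ b, P b ∧ ((u : M) = monomialZ η b ∨ (u : M) = - monomialZ η b) := by
  constructor
  · rintro ⟨x, hx, rfl⟩
    refine ⟨x.2.toAdd, (hH x).1 hx, ?_⟩
    rw [signedMonomial_apply]
    rcases Int.units_eq_one_or x.1 with h | h <;> simp [h]
  · rintro ⟨b, hb, h | h⟩
    · exact ⟨(1, Multiplicative.ofAdd b), (hH _).2 hb, Units.ext (by
        rw [signedMonomial_apply, h]; simp)⟩
    · exact ⟨(-1, Multiplicative.ofAdd b), (hH _).2 hb, Units.ext (by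
        rw [signedMonomial_apply, h]; simp)⟩

variable [LinearOrder M] [IsStrictOrderedRing M]
  {g : (Fin 4 → ℤˣ) → (M ≃+* M)} {η : Fin 7 → M}

lemma ActsBySigns.signedMonomial_injective (h : ActsBySigns g η) (hη : ∀ i, 1 < η i) :
    Function.Injective (signedMonomial η fun i => (zero_lt_one.trans (hη i)).ne') := by
  rw [injective_iff_map_eq_one]
  intro x hx
  have h1 : ((x.1 : ℤ) : M) * monomialZ η x.2.toAdd = 1 := by
    rw [← signedMonomial_apply η fun i => (zero_lt_one.trans (hη i)).ne', hx, Units.val_one]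
  have hs : x.1 = 1 := Int.units_eq_one_of_sq_eq (x := (1 : M)) (monomialZ_pos hη x.2.toAdd)
    (by rw [h1, one_pow])
  rw [hs] at h1
  have h2 := h.monomialZ_injective hη (by simpa using h1)
  exact Prod.ext hs h2

/-- The index of the group `Q` of monomials with even exponents (except for `η 0`) in a group `E`
of elements fixed by `g oddSigns`, closed under square roots, whose fourth powers lie in `Q`. -/
theorem ActsBySigns.relIndex_eq (h : ActsBySigns g η) (hη : ∀ i, 1 < η i)
    (hcomm : ∀ v w x, g v (g w x) = g w (g v x)) {E Q : Subgroup Mˣ}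
    (hfix : ∀ u ∈ E, g oddSigns (u : M) = u)
    (hroot : ∀ u : Mˣ, g oddSigns (u : M) = u → u ^ 2 ∈ E → u ∈ E)
    (hQ : ∀ u : Mˣ, u ∈ Q ↔ ∃ b : Fin 7 → ℤ, (∀ i : Fin 6, Even (b i.succ)) ∧
      ((u : M) = monomialZ η b ∨ (u : M) = - monomialZ η b))
    (hQE : Q ≤ E) (hpow : ∀ u ∈ E, u ^ 4 ∈ Q)
    (hroots : ∃ ρ : M, ρ ^ 2 = η 1 * η 3 * η 4 * η 6 ∧
      (g oddSigns ρ = ρ ∨ g oddSigns ρ = -ρ)) :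
    Q.relIndex E = 64 := by
  have hη0 : ∀ i, η i ≠ 0 := fun i => (zero_lt_one.trans (hη i)).ne'
  set U := tailSumParity.ker.map (signedMonomial η hη0) with hUdef
  have hQmap : Q = tailParity.ker.map (signedMonomial η hη0) := by
    ext u
    rw [hQ, mem_map_signedMonomial η hη0 (fun b => ∀ i : Fin 6, Even (b i.succ)) _
      fun x => mem_ker_tailParity]
  have hU : ∀ u : Mˣ, u ∈ U ↔ ∃ b : Fin 7 → ℤ, Even (b 1 + b 2 + b 3 + b 4 + b 5 + b 6) ∧
      ((u : M) = monomialZ η b ∨ (u : M) = - monomialZ η b) := fun u =>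
    mem_map_signedMonomial η hη0 (fun b => Even (b 1 + b 2 + b 3 + b 4 + b 5 + b 6)) _
      (fun x => mem_ker_tailSumParity) u
  have hQU : Q.relIndex U = 32 := by
    rw [hQmap, hUdef, Subgroup.relIndex_map_map_of_injective _ _ (h.signedMonomial_injective hη),
      relIndex_ker_tailParity]
  have hQleU : Q ≤ U := by
    intro u hu
    obtain ⟨b, hb, hub⟩ := (hQ u).1 hu
    exact (hU u).2 ⟨b, ((((hb 0).add (hb 1)).add (hb 2)).add (hb 3)).add (hb 4) |>.add (hb 5), hub⟩
  have hUE : U ≤ E := by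
    intro u hu
    obtain ⟨b, hb, hub⟩ := (hU u).1 hu
    refine hroot u ?_ (hQE ((hQ _).2 ⟨fun i => 2 * b i, fun i => even_two_mul _, Or.inl ?_⟩))
    · have hm := h.oddSigns_apply_monomialZ b
      rw [hb.neg_one_zpow] at hm
      rcases hub with hub | hub <;> rw [hub] <;> simpa using hm
    · rw [monomialZ_two_smul, Units.val_pow_eq_pow_val]
      rcases hub with hub | hub <;> rw [hub]
      ring
  -- a square root `r` of a monomial with odd exponents exactly at `1, 3, 4, 6`
  obtain ⟨r, hr, c, hrc, hc0, hc⟩ : ∃ r : Mˣ, g oddSigns (r : M) = r ∧ ∃ c : Fin 7 → ℤ,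
      (r : M) ^ 2 = monomialZ η c ∧
      Even (c 0) ∧ Odd (c 1) ∧ Even (c 2) ∧ Odd (c 3) ∧ Odd (c 4) ∧ Even (c 5) ∧ Odd (c 6) := by
    obtain ⟨ρ, hρ, hfixρ⟩ := hroots
    have hρ0 : ρ ≠ 0 := by
      rintro rfl
      simp [hη0] at hρ
    rcases hfixρ with hfixρ | hfixρ
    · refine ⟨Units.mk0 ρ hρ0, hfixρ, ![0, 1, 0, 1, 1, 0, 1], ?_, by decide⟩
      simp [monomialZ, Fin.prod_univ_succ, hρ]
      ring
    · refine ⟨Units.mk0 (ρ * η 1) (mul_ne_zero hρ0 (hη0 1)), ?_, ![0, 3, 0, 1, 1, 0, 1], ?_,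
        by decide⟩
      · have := h oddSigns 1
        simp [factorSign, radicandSign, oddSigns] at this
        simp only [Units.val_mk0, map_mul, hfixρ]
        rw [← oddSigns] at this
        rw [this]
        ring
      · simp [monomialZ, Fin.prod_univ_succ, mul_pow, hρ]
        ring
  have hrE : r ∈ E := by
    refine hroot r hr (hUE ((hU _).2 ⟨c, ?_, Or.inl (by simpa using hrc)⟩))
    simp only [Int.even_iff, Int.odd_iff] at hc ⊢
    omega
  have hrU : r ∉ U := by
    intro hrU
    obtain ⟨b, -, hb⟩ := (hU r).1 hrU
    have h1 : monomialZ η (c + -(fun i => 2 * b i)) = 1 := by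
      rw [monomialZ_add hη0, monomialZ_neg, monomialZ_two_smul, ← hrc]
      rcases hb with hb | hb <;> rw [hb] <;>
        simp [(monomialZ_pos hη b).ne']
    have h2 := congrFun (h.monomialZ_injective hη h1) 1
    simp only [Pi.add_apply, Pi.neg_apply, Pi.zero_apply] at h2
    obtain ⟨k, hk⟩ := hc.1
    omega
  have hrr : r * r ∈ U := by
    refine (hU _).2 ⟨c, ?_, Or.inl (by rw [Units.val_mul, ← sq, hrc])⟩
    simp only [Int.even_iff, Int.odd_iff] at hc ⊢
    omega
  -- square roots of elements of `U`
  have hsqU : ∀ u ∈ E, u ^ 2 ∈ U → u ∈ U ∨ u * r ∈ U := by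
    intro u hu hu2
    obtain ⟨b, hb, hub⟩ := (hU _).1 hu2
    rw [Units.val_pow_eq_pow_val] at hub
    have hub : (u : M) ^ 2 = monomialZ η b := by
      rcases hub with hub | hub
      · exact hub
      · have := sq_nonneg (u : M)
        have := monomialZ_pos hη b
        linarith
    have hpar := h.parities_of_sq hη hcomm (hfix u hu) hub hb
    have finish : ∀ (w : Mˣ) (e : Fin 7 → ℤ), w ∈ E → (w : M) ^ 2 = monomialZ η e →
        (∀ i, Even (e i)) → w ∈ U := by
      intro w e hw hwe he
      choose a ha using fun i => (he i).two_dvd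
      have hor : (w : M) = monomialZ η a ∨ (w : M) = - monomialZ η a := by
        rw [← sq_eq_sq_iff_eq_or_eq_neg, ← monomialZ_two_smul, hwe]
        congr 1
        exact funext ha
      exact (hU w).2 ⟨a, h.even_of_fixed hη (hfix w hw) hor, hor⟩
    rcases Int.even_or_odd (b 1) with h1 | h1
    · left
      refine finish u b hu hub fun i => ?_
      simp only [Int.even_iff] at *
      fin_cases i <;> simp <;> omega
    · right
      refine finish (u * r) (b + c) (E.mul_mem hu hrE) ?_ fun i => ?_
      · rw [Units.val_mul, mul_pow, hub, hrc, monomialZ_add hη0]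
      · simp only [Int.even_iff, Int.odd_iff] at *
        fin_cases i <;> simp <;> omega
  -- `r` times an element of `U` is not a square
  have hnsq : ∀ u ∈ E, u ^ 2 * r ∉ U := by
    intro u hu hur
    obtain ⟨b, hb, hub⟩ := (hU _).1 hur
    set v : Fin 4 → ℤˣ := ![1, -1, 1, 1] with hv
    have hr' := (h.sign_and_parity hη hcomm hr hrc v).2.1
    set z : M := u * g v u with hz
    have hzfix : g oddSigns z = z := by
      rw [hz, map_mul, hcomm, hfix u hu]
    have hzr : z ^ 2 * (r * g v r) = ((monomialSign v b : ℤ) : M) * monomialZ η (fixedPart v b) ^ 2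
        := by
      rw [← h.mul_apply_monomialZ hη0, hz]
      have : (u : M) ^ 2 * r = ((u ^ 2 * r : Mˣ) : M) := by push_cast; rfl
      calc _ = ((u : M) ^ 2 * r) * g v ((u : M) ^ 2 * r) := by
            rw [map_mul, map_pow]; ring
        _ = _ := by
            rw [this]
            rcases hub with hub | hub <;> rw [hub]; simp
    have hz2 : z ^ 2 = monomialZ η ((fun i => 2 * fixedPart v b i) + -fixedPart v c) := by
      have hpos := monomialZ_pos hη (fixedPart v c)
      have hpos' := monomialZ_pos hη (fixedPart v b)
      have hpos'' := sq_nonneg z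
      rw [monomialZ_add hη0, monomialZ_neg, monomialZ_two_smul, ← div_eq_mul_inv,
        eq_div_iff hpos.ne']
      have hsq := pow_pos hpos' 2
      rcases hr' with hr' | hr' <;> rw [hr'] at hzr <;>
        rcases Int.units_eq_one_or (monomialSign v b) with hs | hs <;>
        simp only [hs, Units.val_one, Units.val_neg, Int.cast_one, Int.cast_neg] at hzr <;>
        nlinarith [mul_nonneg hpos''  hpos.le]
    have hpar := h.parities_of_sq hη hcomm hzfix hz2 (by
      simp [fixedPart, radicandSign, hv, show ((-1 : ℤˣ) = 1) = False by decide]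
      simp only [Int.even_iff, Int.odd_iff] at hc ⊢
      omega)
    simp [fixedPart, radicandSign, hv, show ((-1 : ℤˣ) = 1) = False by decide] at hpar
    simp only [Int.even_iff, Int.odd_iff] at hc hpar
    omega
  have hUindex : U.relIndex E = 2 := by
    rw [Subgroup.relIndex_eq_two_iff]
    refine ⟨r, hrE, fun u hu => ?_⟩
    have hor : u ∈ U ∨ u * r ∈ U := by
      have h4 : (u ^ 2) ^ 2 ∈ U := by
        rw [← pow_mul]
        exact hQleU (hpow u hu)
      rcases hsqU _ (E.pow_mem hu 2) h4 with h2 | h2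
      · exact hsqU u hu h2
      · exact absurd h2 (hnsq u hu)
    rcases hor with hu1 | hu1
    · exact Or.inr ⟨hu1, fun hc => hrU ((U.mul_mem_cancel_left hu1).1 hc)⟩
    · refine Or.inl ⟨hu1, fun hc => hrU ((U.mul_mem_cancel_left hc).1 hu1)⟩
  rw [← Subgroup.relIndex_mul_relIndex Q U E hQleU hUE, hQU, hUindex]

end LatticeIndex

section AdjoinSquareRoot

lemma mem_adjoin_insert_of_sq_mem {S : Set ℝ} (hS : ∀ x ∈ S, IsAlgebraic ℚ x) {a : ℝ}
    (ha : a ^ 2 ∈ adjoin ℚ S) {x : ℝ} (hx : x ∈ adjoin ℚ (insert a S)) :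
    ∃ y ∈ adjoin ℚ S, ∃ z ∈ adjoin ℚ S, x = y + z * a := by
  have halgF : ∀ y ∈ adjoin ℚ S, IsAlgebraic ℚ y := by
    intro y hy
    have := isAlgebraic_adjoin (fun x hx => (hS x hx).isIntegral)
    exact (isAlgebraic_iff (x := (⟨y, hy⟩ : adjoin ℚ S))).1 (this.isAlgebraic _)
  have halg : ∀ x ∈ insert a S, IsAlgebraic ℚ x := by
    rintro x (rfl | hx)
    · exact (halgF _ ha).of_pow two_pos
    · exact hS x hx
  rw [← mem_toSubalgebra, adjoin_toSubalgebra_of_isAlgebraic halg] at hx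
  induction hx using Algebra.adjoin_induction with
  | mem x hx =>
    rcases hx with rfl | hx
    · exact ⟨0, zero_mem _, 1, one_mem _, by ring⟩
    · exact ⟨x, subset_adjoin ℚ S hx, 0, zero_mem _, by ring⟩
  | algebraMap r => exact ⟨_, IntermediateField.algebraMap_mem _ r, 0, zero_mem _, by ring⟩
  | add x x' _ _ h h' =>
    obtain ⟨y, hy, z, hz, rfl⟩ := h
    obtain ⟨y', hy', z', hz', rfl⟩ := h'
    exact ⟨y + y', add_mem hy hy', z + z', add_mem hz hz', by ring⟩
  | mul x x' _ _ h h' =>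
    obtain ⟨y, hy, z, hz, rfl⟩ := h
    obtain ⟨y', hy', z', hz', rfl⟩ := h'
    exact ⟨y * y' + z * z' * a ^ 2, add_mem (mul_mem hy hy') (mul_mem (mul_mem hz hz') ha),
      y * z' + z * y', add_mem (mul_mem hy hz') (mul_mem hz hy'), by ring⟩

/-- If `M = F(a)` with `a ∉ F` and `a² ∈ F`, there is an automorphism of `M` fixing `F` and
negating `a`. -/
lemma exists_algEquiv_neg {F M : IntermediateField ℚ ℝ} {a : ℝ} (ha : a ∉ F) (ha2 : a ^ 2 ∈ F)
    (hM : ∀ x, x ∈ M ↔ ∃ y ∈ F, ∃ z ∈ F, x = y + z * a) :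
    ∃ σ : M ≃ₐ[ℚ] M, (∀ x : M, (x : ℝ) ∈ F → σ x = x) ∧ ∀ x : M, (x : ℝ) = a → σ x = -x := by
  have huniq : ∀ {y z y' z' : ℝ}, y ∈ F → z ∈ F → y' ∈ F → z' ∈ F →
      y + z * a = y' + z' * a → y = y' ∧ z = z' := by
    intro y z y' z' hy hz hy' hz' h
    have hzz : z = z' := by
      by_contra hne
      refine ha ?_
      have : a = (y' - y) / (z - z') := by
        rw [eq_div_iff (sub_ne_zero.2 hne)]
        linarith
      rw [this]
      exact div_mem (sub_mem hy' hy) (sub_mem hz hz')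
    subst hzz
    exact ⟨by linarith, rfl⟩
  choose Y hY Z hZ hYZ using fun x : M => (hM x).1 x.2
  have hconj : ∀ x : M, Y x - Z x * a ∈ M := fun x =>
    (hM _).2 ⟨Y x, hY x, -Z x, neg_mem (hZ x), by ring⟩
  have hval : ∀ (x : M) {y z : ℝ}, y ∈ F → z ∈ F → (x : ℝ) = y + z * a →
      Y x - Z x * a = y - z * a := by
    intro x y z hy hz h
    obtain ⟨h1, h2⟩ := huniq (hY x) (hZ x) hy hz ((hYZ x).symm.trans h)
    rw [h1, h2]
  let f : M →ₐ[ℚ] M :=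
    { toFun := fun x => ⟨Y x - Z x * a, hconj x⟩
      map_one' := Subtype.ext (by
        simpa using hval 1 (one_mem F) (zero_mem F) (by simp))
      map_zero' := Subtype.ext (by
        simpa using hval 0 (zero_mem F) (zero_mem F) (by simp))
      map_add' := fun x x' => Subtype.ext (by
        refine (hval (x + x') (add_mem (hY x) (hY x')) (add_mem (hZ x) (hZ x'))
          (by rw [IntermediateField.coe_add, hYZ x, hYZ x']; ring)).trans ?_
        push_cast; ring)
      map_mul' := fun x x' => Subtype.ext (by
        refine (hval (x * x')
          (add_mem (mul_mem (hY x) (hY x')) (mul_mem (mul_mem (hZ x) (hZ x')) ha2))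
          (add_mem (mul_mem (hY x) (hZ x')) (mul_mem (hZ x) (hY x')))
          (by rw [IntermediateField.coe_mul, hYZ x, hYZ x']; ring)).trans ?_
        push_cast; ring)
      commutes' := fun r => Subtype.ext (by
        refine (hval (algebraMap ℚ M r) (IntermediateField.algebraMap_mem F r) (zero_mem F)
          (by simp)).trans ?_
        simp) }
  have hff : f.comp f = AlgHom.id ℚ M := by
    ext x
    change Y (f x) - Z (f x) * a = x
    rw [hval (f x) (hY x) (neg_mem (hZ x)) (by change Y x - Z x * a = _; ring)]
    rw [hYZ x]
    ring
  refine ⟨AlgEquiv.ofAlgHom f f hff hff, fun x hx => Subtype.ext ?_, fun x hx => Subtype.ext ?_⟩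
  · change Y x - Z x * a = x
    rw [hval x hx (zero_mem F) (by simp)]
    simp
  · change Y x - Z x * a = -x
    rw [hval x (zero_mem F) (one_mem F) (by simp [hx]), hx]
    ring

variable {M : IntermediateField ℚ ℝ}

lemma apply_eq_self_of_mem_adjoin {S : Set ℝ} (hSM : S ⊆ M) (g : M ≃ₐ[ℚ] M)
    (hg : ∀ y : M, (y : ℝ) ∈ S → g y = y) (x : M) (hx : (x : ℝ) ∈ adjoin ℚ S) : g x = x := by
  have key : ∀ y ∈ adjoin ℚ S, ∀ hy : y ∈ M, g ⟨y, hy⟩ = ⟨y, hy⟩ := by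
    have hle : adjoin ℚ S ≤ M := adjoin_le_iff.2 hSM
    intro y hy
    induction hy using adjoin_induction with
    | mem y hy => exact fun hyM => hg ⟨y, hyM⟩ hy
    | algebraMap r => exact fun hyM => g.commutes r
    | add y z hy hz h h' =>
      intro _
      have := congrArg₂ (· + ·) (h (hle hy)) (h' (hle hz))
      simp only [← map_add] at this
      exact this
    | mul y z hy hz h h' =>
      intro _
      have := congrArg₂ (· * ·) (h (hle hy)) (h' (hle hz))
      simp only [← map_mul] at this
      exact this
    | inv y hy h =>
      intro _
      have := congrArg (·⁻¹) (h (hle hy))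
      simp only [← map_inv₀] at this
      exact this
  exact key x hx x.2

lemma mem_adjoin_of_fixed {S : Set ℝ} (hS : ∀ x ∈ S, IsAlgebraic ℚ x) (hSM : S ⊆ M) {a : M}
    (ha : (a : ℝ) ^ 2 ∈ adjoin ℚ S) (g : M ≃ₐ[ℚ] M)
    (hg : ∀ y : M, (y : ℝ) ∈ S → g y = y) (hga : g a = -a) {x : M}
    (hx : (x : ℝ) ∈ adjoin ℚ (insert (a : ℝ) S)) (hgx : g x = x) : (x : ℝ) ∈ adjoin ℚ S := by
  obtain ⟨y, hy, z, hz, h⟩ := mem_adjoin_insert_of_sq_mem hS ha hx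
  have hle : adjoin ℚ S ≤ M := adjoin_le_iff.2 hSM
  have hxe : x = ⟨y, hle hy⟩ + ⟨z, hle hz⟩ * a := Subtype.ext h
  have h2 : g x = ⟨y, hle hy⟩ - ⟨z, hle hz⟩ * a := by
    rw [hxe, map_add, map_mul, hga, apply_eq_self_of_mem_adjoin hSM g hg ⟨y, _⟩ hy,
      apply_eq_self_of_mem_adjoin hSM g hg ⟨z, _⟩ hz]
    ring
  rw [hgx] at h2
  have h3 : x = ⟨y, hle hy⟩ := by linear_combination (h2 + hxe) / 2
  rw [h3]
  exact hy

end AdjoinSquareRoot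

section Multiquadratic

variable {ι : Type*}

/-- The field generated over `ℚ` by the square roots of `ℓ j`, `j ∈ T`. -/
def radicalField (ℓ : ι → ℕ) (T : Set ι) : IntermediateField ℚ ℝ :=
  adjoin ℚ ((fun j => Real.sqrt (ℓ j)) '' T)

lemma isAlgebraic_sqrt (n : ℕ) : IsAlgebraic ℚ (Real.sqrt n) := by
  refine IsAlgebraic.of_pow two_pos ?_
  rw [Real.sq_sqrt (Nat.cast_nonneg n)]
  exact isAlgebraic_natCast n

lemma sqrt_mem_radicalField (ℓ : ι → ℕ) {T : Set ι} {j : ι} (hj : j ∈ T) :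
    Real.sqrt (ℓ j) ∈ radicalField ℓ T :=
  subset_adjoin ℚ _ ⟨j, hj, rfl⟩

lemma sqrt_sq_mem (F : IntermediateField ℚ ℝ) (n : ℕ) : Real.sqrt n ^ 2 ∈ F := by
  rw [Real.sq_sqrt (Nat.cast_nonneg n)]
  exact IntermediateField.natCast_mem F n

lemma mem_radicalField_insert (ℓ : ι → ℕ) (T : Set ι) (j : ι) (x : ℝ) :
    x ∈ radicalField ℓ (insert j T) ↔
      ∃ y ∈ radicalField ℓ T, ∃ z ∈ radicalField ℓ T, x = y + z * Real.sqrt (ℓ j) := by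
  constructor
  · intro hx
    rw [radicalField, Set.image_insert_eq] at hx
    refine mem_adjoin_insert_of_sq_mem ?_ (sqrt_sq_mem _ _) hx
    rintro _ ⟨i, -, rfl⟩
    exact isAlgebraic_sqrt _
  · rintro ⟨y, hy, z, hz, rfl⟩
    have hle : radicalField ℓ T ≤ radicalField ℓ (insert j T) :=
      adjoin.mono _ _ _ (Set.image_mono (Set.subset_insert _ _))
    exact add_mem (hle hy) (mul_mem (hle hz) (sqrt_mem_radicalField ℓ (Set.mem_insert _ _)))

/-- If `√n` lies in the field generated by the `√(ℓ j)`, `j ∈ T`, then `n` times a divisor of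
`∏ ℓ j` is a square. -/
lemma exists_isSquare_of_sqrt_mem [DecidableEq ι] (ℓ : ι → ℕ) (T : Finset ι) :
    ∀ n : ℕ, Real.sqrt n ∈ radicalField ℓ T → ∃ P, P ∣ ∏ j ∈ T, ℓ j ∧ IsSquare (n * P) := by
  induction T using Finset.induction_on with
  | empty =>
    intro n hn
    refine ⟨1, one_dvd _, ?_⟩
    simp only [radicalField, Finset.coe_empty, Set.image_empty, adjoin_empty, mem_bot] at hn
    obtain ⟨r, hr⟩ := hn
    by_contra hsq
    rw [mul_one] at hsq
    exact (irrational_sqrt_natCast_iff.2 hsq) ⟨r, hr⟩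
  | insert j T hj ih =>
    intro n hn
    rw [Finset.coe_insert, mem_radicalField_insert] at hn
    obtain ⟨y, hy, z, hz, h⟩ := hn
    have hn2 : Real.sqrt n ^ 2 = n := Real.sq_sqrt (Nat.cast_nonneg n)
    have hj2 : Real.sqrt (ℓ j) ^ 2 = ℓ j := Real.sq_sqrt (Nat.cast_nonneg _)
    have hdvd : ∀ P, P ∣ ∏ i ∈ T, ℓ i → P ∣ ∏ i ∈ insert j T, ℓ i := fun P hP => by
      rw [Finset.prod_insert hj]
      exact hP.mul_left _
    have hmem : Real.sqrt n ∈ radicalField ℓ T →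
        ∃ P, P ∣ ∏ j ∈ insert j T, ℓ j ∧ IsSquare (n * P) := fun h0 => by
      obtain ⟨P, hP, hsq⟩ := ih n h0
      exact ⟨P, hdvd P hP, hsq⟩
    by_cases hz0 : z = 0
    · refine hmem ?_
      rw [h, hz0]
      simpa using hy
    by_cases hy0 : y = 0
    · have hmul : Real.sqrt (n * ℓ j : ℕ) ∈ radicalField ℓ T := by
        rw [Nat.cast_mul, Real.sqrt_mul (Nat.cast_nonneg n), h, hy0,
          show (0 + z * Real.sqrt (ℓ j)) * Real.sqrt (ℓ j) = z * Real.sqrt (ℓ j) ^ 2 by ring]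
        exact mul_mem hz (sqrt_sq_mem _ _)
      obtain ⟨P, hP, hsq⟩ := ih _ hmul
      refine ⟨ℓ j * P, ?_, by rwa [← mul_assoc]⟩
      rw [Finset.prod_insert hj]
      exact Nat.mul_dvd_mul_left _ hP
    · refine hmem ?_
      have hsj : Real.sqrt (ℓ j) ∈ radicalField ℓ T := by
        have : Real.sqrt (ℓ j) = (n - y ^ 2 - z ^ 2 * ℓ j) / (2 * y * z) := by
          rw [eq_div_iff (by positivity), ← hn2, h]
          linear_combination (-z ^ 2) * hj2
        rw [this]
        exact div_mem (sub_mem (sub_mem (IntermediateField.natCast_mem _ n) (pow_mem hy 2))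
          (mul_mem (pow_mem hz 2) (IntermediateField.natCast_mem _ _)))
          (mul_mem (mul_mem (ofNat_mem _ 2) hy) hz)
      rw [h]
      exact add_mem hy (mul_mem hz hsj)

variable (ℓ : ι → ℕ)

/-- The square root of `ℓ j` as an element of the multiquadratic field. -/
def root (j : ι) : radicalField ℓ Set.univ :=
  ⟨Real.sqrt (ℓ j), sqrt_mem_radicalField ℓ (Set.mem_univ j)⟩

lemma root_sq (j : ι) : root ℓ j ^ 2 = ℓ j :=
  Subtype.ext (by simp [root])

variable {ℓ}

lemma root_pos (hℓ : ∀ j, (ℓ j).Prime) (j : ι) : 0 < root ℓ j :=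
  Real.sqrt_pos.2 (Nat.cast_pos.2 (hℓ j).pos)

variable [Fintype ι] [DecidableEq ι]

lemma exists_algEquiv_single (hℓ : ∀ j, (ℓ j).Prime) (hinj : Function.Injective ℓ) (j : ι) :
    ∃ σ : radicalField ℓ Set.univ ≃ₐ[ℚ] radicalField ℓ Set.univ,
      σ (root ℓ j) = - root ℓ j ∧ ∀ i ≠ j, σ (root ℓ i) = root ℓ i := by
  have hj : Real.sqrt (ℓ j) ∉ radicalField ℓ ((Finset.univ.erase j : Finset ι) : Set ι) := by
    intro hmem
    obtain ⟨P, hP, hsq⟩ := exists_isSquare_of_sqrt_mem ℓ _ _ hmem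
    have h1 : ℓ j ∣ P := by
      obtain ⟨k, hk⟩ := hsq
      have h2 : ℓ j ∣ k := by
        have : ℓ j ∣ k * k := hk ▸ dvd_mul_right _ _
        exact ((hℓ j).dvd_mul.1 this).elim id id
      obtain ⟨c, rfl⟩ := h2
      refine ⟨c * c, Nat.eq_of_mul_eq_mul_left (hℓ j).pos ?_⟩
      rw [hk]
      ring
    obtain ⟨i, hi, hdvd⟩ := (Nat.Prime.prime (hℓ j)).exists_mem_finset_dvd (h1.trans hP)
    exact (Finset.mem_erase.1 hi).1 (hinj ((Nat.prime_dvd_prime_iff_eq (hℓ j) (hℓ i)).1 hdvd)).symm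
  obtain ⟨σ, h1, h2⟩ := exists_algEquiv_neg (M := radicalField ℓ Set.univ) hj (sqrt_sq_mem _ _)
    (fun x => by
      rw [← mem_radicalField_insert, ← Finset.coe_insert, Finset.insert_erase (Finset.mem_univ j),
        Finset.coe_univ])
  exact ⟨σ, h2 _ rfl, fun i hi => h1 _ (sqrt_mem_radicalField ℓ (by simpa using hi))⟩

lemma exists_algEquiv_signs (hℓ : ∀ j, (ℓ j).Prime) (hinj : Function.Injective ℓ) (v : ι → ℤˣ) :
    ∃ σ : radicalField ℓ Set.univ ≃ₐ[ℚ] radicalField ℓ Set.univ,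
      ∀ j, σ (root ℓ j) = ((v j : ℤ) : radicalField ℓ Set.univ) * root ℓ j := by
  have key : ∀ T : Finset ι, ∃ σ : radicalField ℓ Set.univ ≃ₐ[ℚ] radicalField ℓ Set.univ,
      (∀ j ∈ T, σ (root ℓ j) = ((v j : ℤ) : radicalField ℓ Set.univ) * root ℓ j) ∧
      ∀ j ∉ T, σ (root ℓ j) = root ℓ j := by
    intro T
    induction T using Finset.induction_on with
    | empty => exact ⟨AlgEquiv.refl, by simp, by simp⟩
    | insert i T hi ih =>
      obtain ⟨σ, h1, h2⟩ := ih
      obtain ⟨τ, h3, h4⟩ := exists_algEquiv_single hℓ hinj i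
      rcases Int.units_eq_one_or (v i) with hv | hv
      · refine ⟨σ, fun j hj => ?_, fun j hj => h2 j fun h => hj (Finset.mem_insert_of_mem h)⟩
        rcases Finset.mem_insert.1 hj with rfl | hj
        · simp [h2 _ hi, hv]
        · exact h1 j hj
      · refine ⟨σ.trans τ, fun j hj => ?_, fun j hj => ?_⟩
        · rcases Finset.mem_insert.1 hj with rfl | hj
          · simp [h2 _ hi, hv, h3]
          · have : j ≠ i := fun h => hi (h ▸ hj)
            simp [h1 j hj, h4 j this]
        · rw [Finset.mem_insert, not_or] at hj
          simp [h2 j hj.2, h4 j hj.1]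
  obtain ⟨σ, h, -⟩ := key Finset.univ
  exact ⟨σ, fun j => h j (Finset.mem_univ j)⟩

/-- The automorphism of the multiquadratic field multiplying `√(ℓ j)` by the sign `v j`. -/
def signAut (hℓ : ∀ j, (ℓ j).Prime) (hinj : Function.Injective ℓ) (v : ι → ℤˣ) :
    radicalField ℓ Set.univ ≃ₐ[ℚ] radicalField ℓ Set.univ :=
  (exists_algEquiv_signs hℓ hinj v).choose

variable (hℓ : ∀ j, (ℓ j).Prime) (hinj : Function.Injective ℓ)

lemma signAut_root (v : ι → ℤˣ) (j : ι) :
    signAut hℓ hinj v (root ℓ j) = ((v j : ℤ) : radicalField ℓ Set.univ) * root ℓ j :=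
  (exists_algEquiv_signs hℓ hinj v).choose_spec j

lemma signAut_mul (v w : ι → ℤˣ) (x : radicalField ℓ Set.univ) :
    signAut hℓ hinj v (signAut hℓ hinj w x) = signAut hℓ hinj (v * w) x := by
  have := apply_eq_self_of_mem_adjoin (M := radicalField ℓ Set.univ) (subset_adjoin ℚ _)
    ((signAut hℓ hinj w).trans ((signAut hℓ hinj v).trans (signAut hℓ hinj (v * w)).symm)) (by
      rintro y ⟨j, -, hj⟩
      obtain rfl : root ℓ j = y := Subtype.ext hj
      rw [AlgEquiv.trans_apply, AlgEquiv.trans_apply, AlgEquiv.symm_apply_eq]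
      simp only [signAut_root, map_mul, map_intCast,
        Pi.mul_apply, Units.val_mul, Int.cast_mul]
      ring) x x.2
  simpa [AlgEquiv.symm_apply_eq] using this

lemma signAut_comm (v w : ι → ℤˣ) (x : radicalField ℓ Set.univ) :
    signAut hℓ hinj v (signAut hℓ hinj w x) = signAut hℓ hinj w (signAut hℓ hinj v x) := by
  rw [signAut_mul, signAut_mul, mul_comm]

lemma signAut_eq_self_of_mem (v : ι → ℤˣ) {T : Set ι} (hT : ∀ j ∈ T, v j = 1)
    (x : radicalField ℓ Set.univ) (hx : (x : ℝ) ∈ radicalField ℓ T) : signAut hℓ hinj v x = x := by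
  refine apply_eq_self_of_mem_adjoin (S := (fun j => Real.sqrt (ℓ j)) '' T) ?_ _ ?_ x hx
  · rintro _ ⟨j, -, rfl⟩
    exact (root ℓ j).2
  · rintro y ⟨j, hj, hy⟩
    obtain rfl : root ℓ j = y := Subtype.ext hy
    simp [signAut_root, hT j hj]

end Multiquadratic

section QuadraticUnits

lemma exists_int_of_isIntegral_ratCast {K : Type*} [Field K] [CharZero K] {r : ℚ}
    (h : IsIntegral ℤ (r : K)) : ∃ n : ℤ, r = n := by
  have h1 : IsIntegral ℤ r :=
    (isIntegral_algebraMap_iff (A := ℚ) (B := K) (algebraMap ℚ K).injective).1 (by simpa using h)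
  obtain ⟨n, hn⟩ := IsIntegrallyClosed.isIntegral_iff.1 h1
  exact ⟨n, by simpa using hn.symm⟩

/-- The group of units of the ring of integers of `F`, as a subgroup of `ℝˣ`. -/
def integralUnits (F : IntermediateField ℚ ℝ) : Subgroup ℝˣ where
  carrier := {u | (u : ℝ) ∈ F ∧ IsIntegral ℤ (u : ℝ) ∧ IsIntegral ℤ ((u⁻¹ : ℝˣ) : ℝ)}
  one_mem' := by simp [isIntegral_one, one_mem]
  mul_mem' := by
    rintro u v ⟨h1, h2, h3⟩ ⟨h4, h5, h6⟩
    refine ⟨mul_mem h1 h4, h2.mul h5, ?_⟩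
    rw [mul_inv]
    exact h3.mul h6
  inv_mem' := by
    rintro u ⟨h1, h2, h3⟩
    refine ⟨?_, h3, by simpa using h2⟩
    rw [Units.val_inv_eq_inv_val]
    exact inv_mem h1

lemma mem_integralUnits {F : IntermediateField ℚ ℝ} {u : ℝˣ} : u ∈ integralUnits F ↔
    (u : ℝ) ∈ F ∧ IsIntegral ℤ (u : ℝ) ∧ IsIntegral ℤ ((u⁻¹ : ℝˣ) : ℝ) := Iff.rfl

lemma neg_mem_integralUnits {F : IntermediateField ℚ ℝ} {u : ℝˣ} (hu : u ∈ integralUnits F) :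
    -u ∈ integralUnits F := by
  obtain ⟨h1, h2, h3⟩ := hu
  exact ⟨by simpa using h1, by simpa using h2.neg, by simpa using h3.neg⟩

lemma mem_adjoin_sqrt_iff {d : ℕ} {x : ℝ} :
    x ∈ adjoin ℚ {√(d : ℝ)} ↔ ∃ a b : ℚ, x = a + b * √(d : ℝ) := by
  constructor
  · intro hx
    obtain ⟨y, hy, z, hz, h⟩ := mem_adjoin_insert_of_sq_mem (S := ∅) (by simp) (sqrt_sq_mem _ d)
      (by simpa using hx)
    simp only [adjoin_empty, mem_bot] at hy hz
    obtain ⟨a, rfl⟩ := hy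
    obtain ⟨b, rfl⟩ := hz
    exact ⟨a, b, by simpa using h⟩
  · rintro ⟨a, b, rfl⟩
    have h (r : ℚ) : (r : ℝ) ∈ adjoin ℚ {√(d : ℝ)} := IntermediateField.algebraMap_mem _ r
    exact add_mem (h a) (mul_mem (h b) (mem_adjoin_simple_self ℚ _))

lemma isIntegral_conj {d : ℕ} (hd : ¬ IsSquare d) {a b : ℚ}
    (h : IsIntegral ℤ (a + b * √(d : ℝ))) : IsIntegral ℤ (a - b * √(d : ℝ)) := by
  have hirr : √(d : ℝ) ∉ (⊥ : IntermediateField ℚ ℝ) := by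
    rw [mem_bot]
    rintro ⟨r, hr⟩
    exact irrational_sqrt_natCast_iff.2 hd ⟨r, hr⟩
  obtain ⟨σ, h1, h2⟩ := exists_algEquiv_neg (M := adjoin ℚ {√(d : ℝ)}) hirr (sqrt_sq_mem _ d)
    (fun x => by
      rw [mem_adjoin_sqrt_iff]
      constructor
      · rintro ⟨a, b, rfl⟩
        exact ⟨a, IntermediateField.algebraMap_mem _ a, b, IntermediateField.algebraMap_mem _ b,
          rfl⟩
      · rintro ⟨y, hy, z, hz, rfl⟩
        rw [mem_bot] at hy hz
        obtain ⟨a, rfl⟩ := hy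
        obtain ⟨b, rfl⟩ := hz
        exact ⟨a, b, rfl⟩)
  let r : adjoin ℚ {√(d : ℝ)} := ⟨√(d : ℝ), mem_adjoin_simple_self ℚ _⟩
  have hx : IsIntegral ℤ ((a : adjoin ℚ {√(d : ℝ)}) + b * r) := by
    refine (isIntegral_algebraMap_iff (B := ℝ) (algebraMap (adjoin ℚ {√(d : ℝ)}) ℝ).injective).1 ?_
    simpa [r] using h
  have hx2 := map_isIntegral_int σ hx
  rw [map_add, map_mul, map_ratCast, map_ratCast, h2 r rfl] at hx2
  have := map_isIntegral_int (algebraMap (adjoin ℚ {√(d : ℝ)}) ℝ) hx2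
  simpa [r, sub_eq_add_neg] using this

/-- A unit of `ℚ(√d)` has integral trace and norm `±1`. -/
lemma exists_trace_norm {d : ℕ} (hd : ¬ IsSquare d) {u : ℝˣ}
    (hu : u ∈ integralUnits (adjoin ℚ {√(d : ℝ)})) :
    ∃ (t : ℤ) (y : ℚ) (n : ℤˣ), 2 * (u : ℝ) = t + y * √(d : ℝ) ∧
      (t : ℚ) ^ 2 - d * y ^ 2 = 4 * ((n : ℤ) : ℚ) := by
  obtain ⟨hmem, hInt, hinv⟩ := hu
  obtain ⟨a, b, hab⟩ := mem_adjoin_sqrt_iff.1 hmem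
  have hsq : √(d : ℝ) ^ 2 = d := Real.sq_sqrt (Nat.cast_nonneg d)
  have hconj := isIntegral_conj hd (hab ▸ hInt)
  obtain ⟨t, ht⟩ := exists_int_of_isIntegral_ratCast (K := ℝ) (r := 2 * a) (by
    have := hInt.add hconj
    rw [hab] at this
    rwa [show ((2 * a : ℚ) : ℝ) = a + b * √(d : ℝ) + (a - b * √(d : ℝ)) by push_cast; ring])
  have hnorm : ((a ^ 2 - d * b ^ 2 : ℚ) : ℝ) = u * (a - b * √(d : ℝ)) := by
    rw [hab]
    push_cast
    linear_combination (b : ℝ) ^ 2 * hsq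
  obtain ⟨n, hn⟩ := exists_int_of_isIntegral_ratCast (K := ℝ) (r := a ^ 2 - d * b ^ 2) (by
    rw [hnorm]
    exact hInt.mul hconj)
  have hn0 : n ≠ 0 := by
    rintro rfl
    rw [hn] at hnorm
    simp only [Int.cast_zero, Rat.cast_zero] at hnorm
    rcases mul_eq_zero.1 hnorm.symm with h | h
    · exact u.ne_zero h
    · have hb : b = 0 := by
        by_contra hb
        refine irrational_sqrt_natCast_iff.2 hd ⟨a / b, ?_⟩
        have : (b : ℝ) ≠ 0 := by exact_mod_cast hb
        push_cast
        rw [div_eq_iff this]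
        linarith
      rw [hb] at h hab
      simp only [Rat.cast_zero, zero_mul, sub_zero, add_zero] at h hab
      exact u.ne_zero (hab.trans h)
  have hinvb : (u⁻¹ : ℝˣ) = ((a / n : ℚ) : ℝ) + ((-b / n : ℚ) : ℝ) * √(d : ℝ) := by
    rw [hn] at hnorm
    have hn1 : (n : ℝ) ≠ 0 := by exact_mod_cast hn0
    rw [Units.val_inv_eq_inv_val, inv_eq_iff_eq_inv, ← inv_eq_iff_eq_inv]
    refine inv_eq_of_mul_eq_one_right ?_
    push_cast at hnorm ⊢
    field_simp
    linear_combination -hnorm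
  have hconj2 := isIntegral_conj hd (hinvb ▸ hinv)
  obtain ⟨n', hn'⟩ := exists_int_of_isIntegral_ratCast (K := ℝ) (r := 1 / n) (by
    have := hinv.mul hconj2
    rw [hinvb] at this
    have hn1 : (n : ℝ) ≠ 0 := by exact_mod_cast hn0
    have hnR : (a : ℝ) ^ 2 - d * b ^ 2 = n := by exact_mod_cast hn
    refine Eq.subst (motive := IsIntegral ℤ) ?_ this
    push_cast
    field_simp
    linear_combination hnR - (b : ℝ) ^ 2 * hsq)
  have hunit : n * n' = 1 := by
    have hn1 : (n : ℚ) ≠ 0 := by exact_mod_cast hn0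
    rw [div_eq_iff hn1] at hn'
    have : (n * n' : ℚ) = 1 := by linear_combination -hn'
    exact_mod_cast this
  refine ⟨t, 2 * b, Units.mkOfMulEqOne n n' hunit, ?_, ?_⟩
  · rw [hab]
    have : (t : ℝ) = 2 * a := by exact_mod_cast ht.symm
    rw [this]
    push_cast
    ring
  · change (t : ℚ) ^ 2 - d * (2 * b) ^ 2 = 4 * (n : ℚ)
    rw [← ht, ← hn]
    ring

lemma mem_integralUnits_of_trace_norm {d : ℕ} {u : ℝˣ} {t : ℤ} {y : ℚ} {n : ℤˣ}
    (hu : 2 * (u : ℝ) = t + y * √(d : ℝ)) (hn : (t : ℚ) ^ 2 - d * y ^ 2 = 4 * ((n : ℤ) : ℚ)) :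
    u ∈ integralUnits (adjoin ℚ {√(d : ℝ)}) := by
  have hsq : √(d : ℝ) ^ 2 = d := Real.sq_sqrt (Nat.cast_nonneg d)
  have hnR : (t : ℝ) ^ 2 - d * y ^ 2 = 4 * ((n : ℤ) : ℝ) := by exact_mod_cast hn
  have hquad : (u : ℝ) ^ 2 - t * u + ((n : ℤ) : ℝ) = 0 := by
    linear_combination (2 * u - t + y * √(d : ℝ)) / 4 * hu - hnR / 4 + (y : ℝ) ^ 2 / 4 * hsq
  have hInt : IsIntegral ℤ (u : ℝ) := by
    refine ⟨Polynomial.X ^ 2 - Polynomial.C t * Polynomial.X + Polynomial.C (n : ℤ), ?_, ?_⟩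
    · monicity!
    · simpa [-eq_intCast, -map_intCast] using hquad
  refine ⟨mem_adjoin_sqrt_iff.2 ⟨t / 2, y / 2, ?_⟩, hInt, ?_⟩
  · push_cast
    linarith
  · have h1 : ((u⁻¹ : ℝˣ) : ℝ) = ((n : ℤ) : ℝ) * (t - u) := by
      have h2 : ((n : ℤ) : ℝ) * ((n : ℤ) : ℝ) = 1 := by
        rcases Int.units_eq_one_or n with rfl | rfl <;> simp
      rw [Units.val_inv_eq_inv_val]
      refine inv_eq_of_mul_eq_one_right ?_
      linear_combination h2 - ((n : ℤ) : ℝ) * hquad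
    rw [h1]
    exact (isIntegral_algebraMap (R := ℤ) (A := ℝ) (x := (n : ℤ))).mul
      ((isIntegral_algebraMap (R := ℤ) (A := ℝ) (x := t)).sub hInt)

lemma three_halves_le_of_one_lt {d : ℕ} (hd : ¬ IsSquare d) {u : ℝˣ}
    (hu : u ∈ integralUnits (adjoin ℚ {√(d : ℝ)})) (h1 : 1 < (u : ℝ)) : 3 / 2 ≤ (u : ℝ) := by
  obtain ⟨t, y, n, h2, h3⟩ := exists_trace_norm hd hu
  have hsq : √(d : ℝ) ^ 2 = d := Real.sq_sqrt (Nat.cast_nonneg d)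
  have hnR : (t : ℝ) ^ 2 - d * y ^ 2 = 4 * ((n : ℤ) : ℝ) := by exact_mod_cast h3
  have hquad : (u : ℝ) ^ 2 - t * u + ((n : ℤ) : ℝ) = 0 := by
    linear_combination (2 * u - t + y * √(d : ℝ)) / 4 * h2 - hnR / 4 + (y : ℝ) ^ 2 / 4 * hsq
  by_contra! hlt
  rcases Int.units_eq_one_or n with rfl | rfl
  · simp only [Units.val_one, Int.cast_one] at hquad
    have h4 : (2 : ℝ) < t := by nlinarith
    have h5 : (3 : ℝ) ≤ t := by
      have : (2 : ℤ) < t := by exact_mod_cast h4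
      exact_mod_cast this
    nlinarith
  · simp only [Units.val_neg, Units.val_one, Int.cast_neg, Int.cast_one] at hquad
    have h4 : (0 : ℝ) < t := by nlinarith
    have h5 : (1 : ℝ) ≤ t := by
      have : (0 : ℤ) < t := by exact_mod_cast h4
      exact_mod_cast this
    nlinarith

/-- The units of a real quadratic field are, up to sign, the powers of a unit `ε > 1`. -/
lemma exists_fundamental_unit {d : ℕ} (hd : ¬ IsSquare d) :
    ∃ ε ∈ integralUnits (adjoin ℚ {√(d : ℝ)}), 1 < (ε : ℝ) ∧
      ∀ u ∈ integralUnits (adjoin ℚ {√(d : ℝ)}), ∃ k : ℤ, u = ε ^ k ∨ u = -ε ^ k := by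
  set U := integralUnits (adjoin ℚ {√(d : ℝ)})
  let H : AddSubgroup ℝ :=
    { carrier := {x | ∃ u ∈ U, (u : ℝ) = Real.exp x}
      zero_mem' := ⟨1, one_mem _, by simp⟩
      add_mem' := by
        rintro x y ⟨u, hu, hx⟩ ⟨v, hv, hy⟩
        exact ⟨u * v, mul_mem hu hv, by rw [Units.val_mul, hx, hy, Real.exp_add]⟩
      neg_mem' := by
        rintro x ⟨u, hu, hx⟩
        exact ⟨u⁻¹, inv_mem hu, by rw [Units.val_inv_eq_inv_val, hx, Real.exp_neg]⟩ }
  obtain ⟨b, hb⟩ := AddSubgroup.cyclic_of_isolated_zero (H := H)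
    (Real.log_pos (show (1 : ℝ) < 3 / 2 by norm_num)) (by
      rw [Set.disjoint_left]
      rintro x ⟨u, hu, hx⟩ ⟨h0, h1⟩
      have := three_halves_le_of_one_lt hd hu (by rw [hx]; exact Real.one_lt_exp_iff.2 h0)
      rw [hx] at this
      exact absurd ((Real.lt_log_iff_exp_lt (by norm_num)).1 h1) (not_lt.2 this))
  have hmem : ∀ x, x ∈ H ↔ ∃ k : ℤ, k • b = x := fun x => by
    rw [hb, AddSubgroup.mem_closure_singleton]
  have hb0 : b ≠ 0 := by
    rintro rfl
    obtain ⟨x, y, hxy, hy⟩ := Pell.exists_of_not_isSquare (d := (d : ℤ))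
      (by exact_mod_cast Nat.pos_of_ne_zero (by rintro rfl; exact hd (IsSquare.zero)))
      (by rwa [Int.isSquare_natCast_iff])
    have hsq : √(d : ℝ) ^ 2 = d := Real.sq_sqrt (Nat.cast_nonneg d)
    have hxyR : (x : ℝ) ^ 2 - d * y ^ 2 = 1 := by exact_mod_cast hxy
    let u : ℝˣ := Units.mkOfMulEqOne (x + y * √(d : ℝ)) (x - y * √(d : ℝ)) (by
      linear_combination hxyR - (y : ℝ) ^ 2 * hsq)
    have hu : u ∈ U := mem_integralUnits_of_trace_norm (t := 2 * x) (y := 2 * y) (n := 1)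
      (by change 2 * (x + y * √(d : ℝ)) = _; push_cast; ring)
      (by
        have : (x : ℚ) ^ 2 - d * y ^ 2 = 1 := by exact_mod_cast hxy
        push_cast
        linear_combination 4 * this)
    have key : ∀ v ∈ U, 0 < (v : ℝ) → v = 1 := by
      intro v hv hpos
      obtain ⟨k, hk⟩ := (hmem (Real.log v)).1 ⟨v, hv, (Real.exp_log hpos).symm⟩
      rw [smul_zero] at hk
      exact Units.ext (Real.eq_one_of_pos_of_log_eq_zero hpos hk.symm)
    have hu1 : (u : ℝ) = 1 ∨ (u : ℝ) = -1 := by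
      rcases lt_or_gt_of_ne u.ne_zero with h | h
      · right
        have := congrArg Units.val (key (-u) (neg_mem_integralUnits hu) (by simpa using h))
        simp only [Units.val_neg, Units.val_one] at this
        linarith
      · left
        exact congrArg Units.val (key u hu h)
    have huv : (u : ℝ) = x + y * √(d : ℝ) := rfl
    have hyR : (y : ℝ) ≠ 0 := by exact_mod_cast hy
    rcases hu1 with h | h
    · refine irrational_sqrt_natCast_iff.2 hd ⟨(1 - x) / y, ?_⟩
      push_cast
      rw [div_eq_iff hyR]
      linarith
    · refine irrational_sqrt_natCast_iff.2 hd ⟨(-1 - x) / y, ?_⟩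
      push_cast
      rw [div_eq_iff hyR]
      linarith
  have hbH : |b| ∈ H := by
    rw [hmem]
    rcases abs_choice b with h | h
    · exact ⟨1, by rw [h, one_smul]⟩
    · exact ⟨-1, by rw [h, neg_smul, one_smul]⟩
  obtain ⟨ε, hε, hεb⟩ := hbH
  refine ⟨ε, hε, by rw [hεb]; exact Real.one_lt_exp_iff.2 (abs_pos.2 hb0), ?_⟩
  have key : ∀ v ∈ U, 0 < (v : ℝ) → ∃ k : ℤ, v = ε ^ k := by
    intro v hv hpos
    obtain ⟨k, hk⟩ := (hmem (Real.log v)).1 ⟨v, hv, (Real.exp_log hpos).symm⟩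
    have h1 : ∃ k : ℤ, k • |b| = Real.log v := by
      rcases abs_choice b with h | h
      · exact ⟨k, by rw [h, hk]⟩
      · exact ⟨-k, by rw [h, neg_smul, smul_neg, neg_neg, hk]⟩
    obtain ⟨k, hk⟩ := h1
    refine ⟨k, Units.ext ?_⟩
    rw [Units.val_zpow_eq_zpow_val, hεb, ← Real.rpow_intCast, ← Real.exp_mul, mul_comm,
      ← zsmul_eq_mul, hk, Real.exp_log hpos]
  intro u hu
  rcases lt_or_gt_of_ne u.ne_zero with h | h
  · obtain ⟨k, hk⟩ := key (-u) (neg_mem_integralUnits hu) (by simpa using h)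
    exact ⟨k, Or.inr (by rw [← hk, neg_neg])⟩
  · obtain ⟨k, hk⟩ := key u hu h
    exact ⟨k, Or.inl hk⟩

end QuadraticUnits

section UnitFactors

lemma exists_int_of_squarefree_mul_sq {d : ℕ} (hd : Squarefree d) {y : ℚ} {c : ℤ}
    (h : d * y ^ 2 = c) : ∃ w : ℤ, y = w := by
  have hd0 : (d : ℚ) ≠ 0 := by exact_mod_cast hd.ne_zero
  have hInt : IsIntegral ℤ ((d * y : ℚ) : ℚ) := by
    refine IsIntegral.of_pow two_pos ?_
    rw [show (d * y) ^ 2 = ((d * c : ℤ) : ℚ) by push_cast; rw [← h]; ring]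
    exact isIntegral_algebraMap (R := ℤ) (A := ℚ)
  obtain ⟨k, hk⟩ := exists_int_of_isIntegral_ratCast (K := ℚ) (r := d * y) (by simpa using hInt)
  have hkd : (d : ℤ) ∣ k ^ 2 := ⟨c, by
    have : (k : ℚ) ^ 2 = d * c := by rw [← hk, ← h]; ring
    exact_mod_cast this⟩
  rw [Squarefree.dvd_pow_iff_dvd (Int.squarefree_natCast.2 hd) two_ne_zero] at hkd
  obtain ⟨w, rfl⟩ := hkd
  refine ⟨w, mul_left_cancel₀ hd0 ?_⟩
  rw [hk]
  push_cast
  ring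

lemma prime_dvd_two_mul {d m l : ℕ} (hm : Squarefree m) {z w : ℤ}
    (h : (m * z) ^ 2 - d * w ^ 2 = 4 * m) (hl : l.Prime) (hlm : l ∣ m) : l ∣ 2 * d := by
  by_contra hnd
  have hlZ : Prime (l : ℤ) := Nat.prime_iff_prime_int.1 hl
  have h2 : ¬ (l : ℤ) ∣ 2 := fun h => hnd (Dvd.dvd.mul_right (by exact_mod_cast h) d)
  have hd : ¬ (l : ℤ) ∣ d := fun h => hnd (Dvd.dvd.mul_left (by exact_mod_cast h) 2)
  obtain ⟨m', rfl⟩ := hlm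
  push_cast at h
  have hw : (l : ℤ) ∣ w := by
    have : (l : ℤ) ∣ d * w ^ 2 := ⟨l * (m' * z) ^ 2 - 4 * m', by linear_combination -h⟩
    exact hlZ.dvd_of_dvd_pow ((hlZ.dvd_mul.1 this).resolve_left hd)
  obtain ⟨w', rfl⟩ := hw
  have hm' : (l : ℤ) ∣ 2 * (2 * m') := ⟨(m' * z) ^ 2 - d * w' ^ 2, by
    refine mul_left_cancel₀ hlZ.ne_zero ?_
    linear_combination -h⟩
  have := (hlZ.dvd_mul.1 ((hlZ.dvd_mul.1 hm').resolve_left h2)).resolve_left h2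
  have hdvd : l * l ∣ l * m' := Nat.mul_dvd_mul_left l (by exact_mod_cast this)
  exact hl.one_lt.ne' (Nat.isUnit_iff.1 (hm l hdvd))

section PrimeFactor

variable {r : ℕ} [Fact r.Prime]

lemma ZMod.two_ne_zero_of_ne (hr : r ≠ 2) : (2 : ZMod r) ≠ 0 := by
  intro h
  have : r ∣ 2 := (ZMod.natCast_eq_zero_iff 2 r).1 (by exact_mod_cast h)
  exact hr ((Nat.prime_dvd_prime_iff_eq Fact.out Nat.prime_two).1 this)

lemma legendreSym_eq_one_of_not_dvd (hr : r ≠ 2) {d m : ℕ} {z w : ℤ}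
    (h : (m * z) ^ 2 - d * w ^ 2 = 4 * m) (hd : r ∣ d) (hm : ¬ r ∣ m) :
    legendreSym r (m : ℤ) = 1 := by
  have hm0 : ((m : ℤ) : ZMod r) ≠ 0 := by
    rwa [Int.cast_natCast, Ne, ZMod.natCast_eq_zero_iff]
  rw [legendreSym.eq_one_iff r hm0]
  have h2 := ZMod.two_ne_zero_of_ne hr
  have hd0 : (d : ZMod r) = 0 := (ZMod.natCast_eq_zero_iff d r).2 hd
  have h' := congrArg (Int.cast : ℤ → ZMod r) h
  push_cast at h'
  rw [hd0] at h'
  refine ⟨m * z / 2, ?_⟩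
  push_cast
  field_simp
  linear_combination -h'

lemma legendreSym_eq_one_of_dvd {d m : ℕ} (hr : r ≠ 2) {z w : ℤ}
    (h : ((r * m : ℕ) * z) ^ 2 - (r * d : ℕ) * w ^ 2 = 4 * (r * m : ℕ)) (hm : ¬ r ∣ m) :
    legendreSym r (-1 * d * m) = 1 := by
  have hr0 : (r : ℤ) ≠ 0 := by exact_mod_cast (Fact.out : r.Prime).ne_zero
  have h1 : r * (m * z) ^ 2 - d * w ^ 2 = 4 * m := by
    refine mul_left_cancel₀ hr0 ?_
    push_cast at h
    linear_combination h
  have h' := congrArg (Int.cast : ℤ → ZMod r) h1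
  push_cast at h'
  rw [CharP.cast_eq_zero (ZMod r) r] at h'
  have h2 := ZMod.two_ne_zero_of_ne hr
  have hm0 : (m : ZMod r) ≠ 0 := by rwa [Ne, ZMod.natCast_eq_zero_iff]
  have hne : -(d : ZMod r) * w ^ 2 ≠ 0 := by
    rw [show -(d : ZMod r) * w ^ 2 = 2 * 2 * m by linear_combination h']
    exact mul_ne_zero (mul_ne_zero h2 h2) hm0
  have hd0 := left_ne_zero_of_mul hne
  have hw0 : (w : ZMod r) ≠ 0 := fun h => right_ne_zero_of_mul hne (by simp [h])
  rw [legendreSym.eq_one_iff r (by push_cast; rw [neg_one_mul]; exact mul_ne_zero hd0 hm0)]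
  refine ⟨2 * m / w, ?_⟩
  push_cast
  field_simp
  linear_combination h'

/-- The possible squarefree parts `m` of `ε + ε⁻¹ + 2` for a unit `ε` of norm one of
`ℚ(√(e r₁ r₂))`. -/
lemma factor_cases {r₁ r₂ : ℕ} [Fact r₁.Prime] [Fact r₂.Prime] {e m : ℕ} (he : e = 1 ∨ e = 2)
    (h1 : r₁ ≠ 2) (h2 : r₂ ≠ 2) (h12 : r₁ ≠ r₂) (hm : Squarefree m) {z w : ℤ}
    (h : (m * z) ^ 2 - (e * r₁ * r₂ : ℕ) * w ^ 2 = 4 * m) :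
    ∃ a b c, (a = 1 ∨ a = 2) ∧ m = a * b * c ∧
      ((b = 1 ∧ legendreSym r₁ (a * c) = 1) ∨
        (b = r₁ ∧ legendreSym r₁ (-1 * (e * r₂) * (a * c)) = 1)) ∧
      ((c = 1 ∧ legendreSym r₂ (a * b) = 1) ∨
        (c = r₂ ∧ legendreSym r₂ (-1 * (e * r₁) * (a * b)) = 1)) := by
  have hp1 : r₁.Prime := Fact.out
  have hp2 : r₂.Prime := Fact.out
  have hdvd : m ∣ 2 * r₁ * r₂ := by
    rw [← Nat.prod_primeFactors_of_squarefree hm]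
    have hsub : m.primeFactors ⊆ {2, r₁, r₂} := by
      intro l hl
      have hlp := Nat.prime_of_mem_primeFactors hl
      have := prime_dvd_two_mul hm h hlp (Nat.dvd_of_mem_primeFactors hl)
      rw [hlp.dvd_mul, hlp.dvd_mul, hlp.dvd_mul, Nat.prime_dvd_prime_iff_eq hlp hp1,
        Nat.prime_dvd_prime_iff_eq hlp hp2, Nat.prime_dvd_prime_iff_eq hlp Nat.prime_two] at this
      simp only [Finset.mem_insert, Finset.mem_singleton]
      rcases this with h | (h | h) | h
      · exact Or.inl h
      · rcases he with rfl | rfl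
        · exact absurd (Nat.dvd_one.1 h) hlp.one_lt.ne'
        · exact Or.inl ((Nat.prime_dvd_prime_iff_eq hlp Nat.prime_two).1 h)
      · exact Or.inr (Or.inl h)
      · exact Or.inr (Or.inr h)
    refine (Finset.prod_dvd_prod_of_subset _ _ (fun l => l) hsub).trans ?_
    rw [Finset.prod_insert (by simp [h1.symm, h2.symm]), Finset.prod_insert (by simpa using h12),
      Finset.prod_singleton, mul_assoc]
  obtain ⟨ab, c, hab, hc, rfl⟩ := (Nat.dvd_mul).1 hdvd
  obtain ⟨a, b, ha, hb, rfl⟩ := (Nat.dvd_mul).1 hab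
  have ha := (Nat.dvd_prime Nat.prime_two).1 ha
  have hb := (Nat.dvd_prime hp1).1 hb
  have hc := (Nat.dvd_prime hp2).1 hc
  have hd1 : ∀ {x : ℕ}, r₁ ∣ x → (x = 1 ∨ x = 2 ∨ x = r₂) → False := by
    rintro x hx (rfl | rfl | rfl)
    · exact hp1.one_lt.ne' (Nat.dvd_one.1 hx)
    · exact h1 ((Nat.prime_dvd_prime_iff_eq hp1 Nat.prime_two).1 hx)
    · exact h12 ((Nat.prime_dvd_prime_iff_eq hp1 hp2).1 hx)
  have hd2 : ∀ {x : ℕ}, r₂ ∣ x → (x = 1 ∨ x = 2 ∨ x = r₁) → False := by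
    rintro x hx (rfl | rfl | rfl)
    · exact hp2.one_lt.ne' (Nat.dvd_one.1 hx)
    · exact h2 ((Nat.prime_dvd_prime_iff_eq hp2 Nat.prime_two).1 hx)
    · exact h12 ((Nat.prime_dvd_prime_iff_eq hp2 hp1).1 hx).symm
  have hac : ¬ r₁ ∣ a * c := fun h => (hp1.dvd_mul.1 h).elim (fun h => hd1 h (by tauto))
    (fun h => hd1 h (by tauto))
  have hab' : ¬ r₂ ∣ a * b := fun h => (hp2.dvd_mul.1 h).elim (fun h => hd2 h (by tauto))
    (fun h => hd2 h (by tauto))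
  refine ⟨a, b, c, ha, rfl, ?_, ?_⟩
  · rcases hb with rfl | rfl
    · refine Or.inl ⟨rfl, ?_⟩
      rw [mul_one] at h
      exact_mod_cast legendreSym_eq_one_of_not_dvd h1 h ⟨e * r₂, by ring⟩ hac
    · refine Or.inr ⟨rfl, ?_⟩
      rw [show a * b * c = b * (a * c) by ring, show e * b * r₂ = b * (e * r₂) by ring] at h
      exact_mod_cast legendreSym_eq_one_of_dvd h1 h hac
  · rcases hc with rfl | rfl
    · refine Or.inl ⟨rfl, ?_⟩
      rw [mul_one] at h
      exact_mod_cast legendreSym_eq_one_of_not_dvd h2 h ⟨e * r₁, by ring⟩ hab'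
    · refine Or.inr ⟨rfl, ?_⟩
      rw [show a * b * c = c * (a * b) by ring, show e * r₁ * c = c * (e * r₁) by ring] at h
      exact_mod_cast legendreSym_eq_one_of_dvd h2 h hab'

end PrimeFactor

/-- If `d` has a prime factor `r ≡ 3 (mod 4)` and `m` is the only possible squarefree part of
`ε + ε⁻¹ + 2`, then the square root of the fundamental unit of `ℚ(√d)` lies in `ℚ(√d, √m)`. -/
theorem exists_sqrt_fundamental_unit {d m r : ℕ} (hd : Squarefree d) (hr : r.Prime)
    (hr4 : r % 4 = 3) (hrd : r ∣ d)
    (hm : ∀ (m₀ : ℕ) (z w : ℤ), Squarefree m₀ → (m₀ * z) ^ 2 - d * w ^ 2 = 4 * m₀ →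
      m₀ ≠ 1 → m₀ ≠ d → m₀ = m) :
    ∃ (η : ℝ) (z : ℕ) (t y : ℤ), 1 < η ∧ z ≠ 0 ∧ η * (z * √(m : ℝ)) = 1 + η ^ 2 ∧
      2 * η ^ 2 = t + y * √(d : ℝ) ∧ t ^ 2 - d * y ^ 2 = 4 ∧
      ∀ u : ℝˣ, u ∈ integralUnits (adjoin ℚ {√(d : ℝ)}) ↔
        ∃ k : ℤ, (u : ℝ) = (η ^ 2) ^ k ∨ (u : ℝ) = -(η ^ 2) ^ k := by
  have hsq : ¬ IsSquare d := by
    rintro ⟨k, rfl⟩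
    have hk := Nat.isUnit_iff.1 (hd k dvd_rfl)
    rw [hk] at hrd
    exact hr.one_lt.ne' (Nat.dvd_one.1 hrd)
  obtain ⟨ε, hε, hε1, hgen⟩ := exists_fundamental_unit hsq
  obtain ⟨t, y, n, h1, h2⟩ := exists_trace_norm hsq hε
  obtain ⟨y, rfl⟩ := exists_int_of_squarefree_mul_sq hd (y := y) (c := t ^ 2 - 4 * n) (by
    push_cast
    linear_combination -h2)
  have h2 : t ^ 2 - d * y ^ 2 = 4 * n := by exact_mod_cast h2
  have := Fact.mk hr
  obtain rfl : n = 1 := by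
    refine (Int.units_eq_one_or n).resolve_right ?_
    rintro rfl
    have h3 := congrArg (Int.cast : ℤ → ZMod r) h2
    push_cast at h3
    rw [(ZMod.natCast_eq_zero_iff d r).2 hrd] at h3
    have h20 : (2 : ZMod r) ≠ 0 := ZMod.two_ne_zero_of_ne (by rintro rfl; omega)
    refine ZMod.exists_sq_eq_neg_one_iff.1 ⟨(t : ZMod r) / 2, ?_⟩ hr4
    field_simp
    linear_combination -h3
  rw [Units.val_one, mul_one] at h2
  have hsqrt : √(d : ℝ) ^ 2 = d := Real.sq_sqrt (Nat.cast_nonneg d)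
  have h2R : (t : ℝ) ^ 2 - d * y ^ 2 = 4 := by exact_mod_cast h2
  rw [Rat.cast_intCast] at h1
  have hquad : (ε : ℝ) ^ 2 - t * ε + 1 = 0 := by
    linear_combination (2 * ε - t + y * √(d : ℝ)) / 4 * h1 - h2R / 4 + (y : ℝ) ^ 2 / 4 * hsqrt
  have ht : 2 < t := by
    have : (2 : ℝ) < t := by nlinarith
    exact_mod_cast this
  obtain ⟨m₀, z, hzm, hm₀⟩ := Nat.sq_mul_squarefree (t + 2).toNat
  have hzm : (z : ℤ) ^ 2 * m₀ = t + 2 := by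
    have := congrArg (Nat.cast : ℕ → ℤ) hzm
    rw [Int.toNat_of_nonneg (by omega)] at this
    exact_mod_cast this
  have hz0 : (z : ℤ) ≠ 0 := fun h => by
    rw [h] at hzm
    omega
  have hz0Q : (z : ℚ) ≠ 0 := by exact_mod_cast hz0
  obtain ⟨w, hw⟩ := exists_int_of_squarefree_mul_sq hd (y := y / z) (c := m₀ * (t - 2)) (by
    have h3 : (t : ℚ) ^ 2 - d * y ^ 2 = 4 := by exact_mod_cast h2
    have h4 : (z : ℚ) ^ 2 * m₀ = t + 2 := by exact_mod_cast hzm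
    field_simp
    push_cast
    linear_combination -h3 - (t - 2 : ℚ) * h4)
  have hyw : y = w * z := by
    rw [div_eq_iff hz0Q] at hw
    exact_mod_cast hw
  have heq : (m₀ * z : ℤ) ^ 2 - d * w ^ 2 = 4 * m₀ := by
    refine mul_left_cancel₀ (pow_ne_zero 2 hz0) ?_
    rw [hyw] at h2
    linear_combination (m₀ * z ^ 2 + t - 2) * hzm + h2
  have hε0 : (0 : ℝ) < ε := zero_lt_one.trans hε1
  have hη2 : √(ε : ℝ) ^ 2 = ε := Real.sq_sqrt hε0.le
  have hη : √(ε : ℝ) * (z * √(m₀ : ℝ)) = 1 + ε := by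
    have h3 : (z : ℝ) ^ 2 * m₀ = t + 2 := by exact_mod_cast hzm
    refine (sq_eq_sq₀ (by positivity) (by positivity)).1 ?_
    rw [mul_pow, mul_pow, hη2, Real.sq_sqrt (Nat.cast_nonneg m₀), h3]
    linear_combination -hquad
  have hnot : √(m₀ : ℝ) ∉ adjoin ℚ {√(d : ℝ)} := by
    intro hmem
    have hηmem : √(ε : ℝ) ∈ adjoin ℚ {√(d : ℝ)} := by
      have hpos : (z : ℝ) * √(m₀ : ℝ) ≠ 0 := by
        intro h
        rw [h] at hη
        linarith
      rw [eq_div_of_mul_eq hpos hη]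
      exact div_mem (add_mem (one_mem _) hε.1)
        (mul_mem (IntermediateField.natCast_mem _ z) hmem)
    obtain ⟨k, hk⟩ := hgen (Units.mk0 (√(ε : ℝ)) (Real.sqrt_pos.2 hε0).ne') (by
      refine ⟨hηmem, IsIntegral.of_pow two_pos ?_, IsIntegral.of_pow two_pos ?_⟩
      · rw [Units.val_mk0, hη2]
        exact hε.2.1
      · rw [Units.val_inv_eq_inv_val, Units.val_mk0, inv_pow, hη2, ← Units.val_inv_eq_inv_val]
        exact hε.2.2)
    have hk2 : (ε : ℝ) ^ (1 : ℤ) = (ε : ℝ) ^ (k * 2) := by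
      rw [zpow_one, zpow_mul, ← hη2]
      rcases hk with hk | hk
      · have := congrArg Units.val hk
        rw [Units.val_mk0, Units.val_zpow_eq_zpow_val] at this
        rw [hη2, ← this]
        exact hη2.symm
      · have := congrArg Units.val hk
        rw [Units.val_mk0, Units.val_neg, Units.val_zpow_eq_zpow_val] at this
        rw [hη2, ← neg_eq_iff_eq_neg.2 this]
        norm_cast
        rw [neg_sq, hη2]
    have := zpow_right_injective₀ hε0 hε1.ne' hk2
    omega
  obtain rfl := hm m₀ z w hm₀ heq (by rintro rfl; exact hnot (by simp [one_mem]))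
    (by rintro rfl; exact hnot (mem_adjoin_simple_self ℚ _))
  refine ⟨√(ε : ℝ), z, t, y, ?_, by exact_mod_cast hz0, by rw [hη, hη2], by rw [hη2, h1], h2,
    fun u => ?_⟩
  · rw [Real.lt_sqrt zero_le_one]
    simpa using hε1
  · rw [hη2]
    constructor
    · intro hu
      obtain ⟨k, hk⟩ := hgen u hu
      refine ⟨k, hk.imp (fun h => ?_) fun h => ?_⟩
      · rw [h, Units.val_zpow_eq_zpow_val]
      · rw [h, Units.val_neg, Units.val_zpow_eq_zpow_val]
    · rintro ⟨k, hk⟩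
      have h3 : u = ε ^ k ∨ u = -ε ^ k := by
        refine hk.imp (fun h => Units.ext ?_) fun h => Units.ext ?_
        · rw [h, Units.val_zpow_eq_zpow_val]
        · rw [h, Units.val_neg, Units.val_zpow_eq_zpow_val]
      rcases h3 with rfl | rfl
      · exact zpow_mem hε k
      · exact neg_mem_integralUnits (zpow_mem hε k)

end UnitFactors

section PrimeTriple

/-- The seven radicands. -/
def radicand (p q s : ℕ) : Fin 7 → ℕ :=
  ![2, p * q, p * s, q * s, 2 * p * q, 2 * p * s, 2 * q * s]

/-- The squarefree parts of `ε + ε⁻¹ + 2` for the fundamental units `ε` of norm one. -/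
def unitFactor (p s : ℕ) : Fin 7 → ℕ := ![2, p, p, s, 2 * p, s, 2 * s]

/-- The congruence and residue conditions on the primes `p`, `q`, `s`. -/
structure IsResidueTriple (p q s : ℕ) : Prop where
  prime_p : p.Prime
  prime_q : q.Prime
  prime_s : s.Prime
  p_mod : p % 8 = 5
  s_mod : s % 8 = 3
  q_mod : q % 8 = 7
  legendre_pq : @legendreSym q ⟨prime_q⟩ (p : ℤ) = 1
  legendre_ps : @legendreSym s ⟨prime_s⟩ (p : ℤ) = 1
  legendre_sq : @legendreSym q ⟨prime_q⟩ (s : ℤ) = 1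

namespace IsResidueTriple

variable {p q s : ℕ}

lemma unitFactor_eq (h : IsResidueTriple p q s) (i : Fin 6) {m : ℕ} {z w : ℤ} (hm : Squarefree m)
    (heq : (m * z) ^ 2 - radicand p q s i.succ * w ^ 2 = 4 * m) (h1 : m ≠ 1)
    (hd : m ≠ radicand p q s i.succ) : m = unitFactor p s i.succ := by
  have := Fact.mk h.prime_p
  have := Fact.mk h.prime_q
  have := Fact.mk h.prime_s
  have hp8 := h.p_mod
  have hq8 := h.q_mod
  have hs8 := h.s_mod
  have hp2 : p ≠ 2 := by omega
  have hq2 : q ≠ 2 := by omega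
  have hs2 : s ≠ 2 := by omega
  have hpq : p ≠ q := by omega
  have hps : p ≠ s := by omega
  have hqs : q ≠ s := by omega
  have a1 : legendreSym p 2 = -1 := by
    rw [legendreSym.at_two hp2, ZMod.χ₈_nat_eq_if_mod_eight, if_neg (by omega), if_neg (by omega)]
  have a2 : legendreSym p (-1) = 1 := by
    rw [legendreSym.at_neg_one hp2, ZMod.χ₄_nat_one_mod_four (by omega)]
  have b1 : legendreSym q 2 = 1 := by
    rw [legendreSym.at_two hq2, ZMod.χ₈_nat_eq_if_mod_eight, if_neg (by omega), if_pos (by omega)]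
  have b2 : legendreSym q (-1) = -1 := by
    rw [legendreSym.at_neg_one hq2, ZMod.χ₄_nat_three_mod_four (by omega)]
  have c1 : legendreSym s 2 = -1 := by
    rw [legendreSym.at_two hs2, ZMod.χ₈_nat_eq_if_mod_eight, if_neg (by omega), if_neg (by omega)]
  have c2 : legendreSym s (-1) = -1 := by
    rw [legendreSym.at_neg_one hs2, ZMod.χ₄_nat_three_mod_four (by omega)]
  have b3 : legendreSym q p = 1 := h.legendre_pq
  have b4 : legendreSym q s = 1 := h.legendre_sq
  have c3 : legendreSym s p = 1 := h.legendre_ps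
  have a3 : legendreSym p q = 1 := by
    rw [← legendreSym.quadratic_reciprocity_one_mod_four (by omega) hq2, b3]
  have a4 : legendreSym p s = 1 := by
    rw [← legendreSym.quadratic_reciprocity_one_mod_four (by omega) hs2, c3]
  have c4 : legendreSym s q = -1 := by
    rw [legendreSym.quadratic_reciprocity_three_mod_four (by omega) (by omega), b4]
  have key : ∀ {e r₁ r₂ : ℕ} [Fact r₁.Prime] [Fact r₂.Prime], (e = 1 ∨ e = 2) → r₁ ≠ 2 → r₂ ≠ 2 →
      r₁ ≠ r₂ → radicand p q s i.succ = e * r₁ * r₂ → _ := fun he h1 h2 h12 hrad =>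
    factor_cases he h1 h2 h12 hm (hrad ▸ heq)
  fin_cases i
  · obtain ⟨a, b, c, rfl | rfl, rfl, ⟨rfl, hb⟩ | ⟨rfl, hb⟩, ⟨rfl, hc⟩ | ⟨rfl, hc⟩⟩ :=
      key (e := 1) (r₁ := p) (r₂ := q) (Or.inl rfl) hp2 hq2 hpq (by simp [radicand]) <;>
    simp only [legendreSym.mul, legendreSym.at_one, Nat.cast_one, Nat.cast_ofNat, a1, a2, a3,
      b1, b2, b3] at hb hc <;>
    simp [radicand, unitFactor] at hb hc h1 hd ⊢
  · obtain ⟨a, b, c, rfl | rfl, rfl, ⟨rfl, hb⟩ | ⟨rfl, hb⟩, ⟨rfl, hc⟩ | ⟨rfl, hc⟩⟩ :=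
      key (e := 1) (r₁ := p) (r₂ := s) (Or.inl rfl) hp2 hs2 hps (by simp [radicand]) <;>
    simp only [legendreSym.mul, legendreSym.at_one, Nat.cast_one, Nat.cast_ofNat, a1, a2, a4,
      c1, c2, c3] at hb hc <;>
    simp [radicand, unitFactor] at hb hc h1 hd ⊢
  · obtain ⟨a, b, c, rfl | rfl, rfl, ⟨rfl, hb⟩ | ⟨rfl, hb⟩, ⟨rfl, hc⟩ | ⟨rfl, hc⟩⟩ :=
      key (e := 1) (r₁ := q) (r₂ := s) (Or.inl rfl) hq2 hs2 hqs (by simp [radicand]) <;>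
    simp only [legendreSym.mul, legendreSym.at_one, Nat.cast_one, Nat.cast_ofNat, b1, b2, b4,
      c1, c2, c4] at hb hc <;>
    simp [radicand, unitFactor] at hb hc h1 hd ⊢
  · obtain ⟨a, b, c, rfl | rfl, rfl, ⟨rfl, hb⟩ | ⟨rfl, hb⟩, ⟨rfl, hc⟩ | ⟨rfl, hc⟩⟩ :=
      key (e := 2) (r₁ := p) (r₂ := q) (Or.inr rfl) hp2 hq2 hpq (by simp [radicand]) <;>
    simp only [legendreSym.mul, legendreSym.at_one, Nat.cast_one, Nat.cast_ofNat, a1, a2, a3,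
      b1, b2, b3] at hb hc <;>
    simp [radicand, unitFactor] at hb hc h1 hd ⊢
  · obtain ⟨a, b, c, rfl | rfl, rfl, ⟨rfl, hb⟩ | ⟨rfl, hb⟩, ⟨rfl, hc⟩ | ⟨rfl, hc⟩⟩ :=
      key (e := 2) (r₁ := p) (r₂ := s) (Or.inr rfl) hp2 hs2 hps (by simp [radicand]) <;>
    simp only [legendreSym.mul, legendreSym.at_one, Nat.cast_one, Nat.cast_ofNat, a1, a2, a4,
      c1, c2, c3] at hb hc <;>
    simp [radicand, unitFactor] at hb hc h1 hd ⊢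
  · obtain ⟨a, b, c, rfl | rfl, rfl, ⟨rfl, hb⟩ | ⟨rfl, hb⟩, ⟨rfl, hc⟩ | ⟨rfl, hc⟩⟩ :=
      key (e := 2) (r₁ := q) (r₂ := s) (Or.inr rfl) hq2 hs2 hqs (by simp [radicand]) <;>
    simp only [legendreSym.mul, legendreSym.at_one, Nat.cast_one, Nat.cast_ofNat, b1, b2, b4,
      c1, c2, c4] at hb hc <;>
    simp [radicand, unitFactor] at hb hc h1 hd ⊢

end IsResidueTriple

end PrimeTriple

namespace IntermediateField

variable {K E : Type*} [Field K] [Field E] [Algebra K E] (F : IntermediateField K E)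

lemma coe_ofNat (n : ℕ) [n.AtLeastTwo] : ((ofNat(n) : F) : E) = ofNat(n) := rfl

lemma coe_zpow (x : F) (k : ℤ) : ((x ^ k : F) : E) = (x : E) ^ k := map_zpow₀ (algebraMap F E) x k

end IntermediateField

section RootProducts

variable {ι : Type*} (ℓ : ι → ℕ)

/-- The product of the `√(ℓ j)`, `j ∈ T`. -/
def rootProd (T : Finset ι) : radicalField ℓ Set.univ := ∏ j ∈ T, root ℓ j

lemma coe_rootProd (T : Finset ι) : (rootProd ℓ T : ℝ) = √((∏ j ∈ T, ℓ j : ℕ) : ℝ) := by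
  classical
  induction T using Finset.induction_on with
  | empty => simp [rootProd]
  | insert j T hj ih =>
    rw [rootProd, Finset.prod_insert hj, Finset.prod_insert hj, IntermediateField.coe_mul,
      Nat.cast_mul, Real.sqrt_mul (Nat.cast_nonneg _), ← ih]
    rfl

lemma rootProd_sq (T : Finset ι) : rootProd ℓ T ^ 2 = ((∏ j ∈ T, ℓ j : ℕ) : ℚ) := by
  refine Subtype.ext ?_
  have := coe_rootProd ℓ T
  push_cast [this]
  rw [Real.sq_sqrt (Finset.prod_nonneg fun j _ => Nat.cast_nonneg _)]

variable {ℓ} [Fintype ι] [DecidableEq ι] (hℓ : ∀ j, (ℓ j).Prime) (hinj : Function.Injective ℓ)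

include hℓ in
omit [Fintype ι] [DecidableEq ι] in
lemma rootProd_pos (T : Finset ι) : 0 < rootProd ℓ T :=
  Finset.prod_pos fun j _ => root_pos hℓ j

lemma signAut_rootProd (v : ι → ℤˣ) (T : Finset ι) :
    signAut hℓ hinj v (rootProd ℓ T) =
      (((∏ j ∈ T, v j : ℤˣ) : ℤ) : radicalField ℓ Set.univ) * rootProd ℓ T := by
  simp only [rootProd, map_prod, signAut_root, Finset.prod_mul_distrib, Units.coe_prod,
    Int.cast_prod]

end RootProducts

section UnitRoots

/-- The primes whose square roots generate the ambient multiquadratic field. -/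
def basePrime (p q s : ℕ) : Fin 4 → ℕ := ![2, p, q, s]

/-- The field `ℚ(√2, √p, √q, √s)`. -/
abbrev ambientField (p q s : ℕ) : IntermediateField ℚ ℝ := radicalField (basePrime p q s) Set.univ

/-- The prime factors of the radicands, as sets of indices. -/
def radicandSupport : Fin 7 → Finset (Fin 4) :=
  ![{0}, {1, 2}, {1, 3}, {2, 3}, {0, 1, 2}, {0, 1, 3}, {0, 2, 3}]

/-- The prime factors of the `unitFactor`s, as sets of indices. -/
def factorSupport : Fin 7 → Finset (Fin 4) := ![{0}, {1}, {1}, {3}, {0, 1}, {3}, {0, 3}]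

/-- The exponents with which the `η i` occur in the units of the quadratic subfields. -/
def unitExponent : Fin 7 → ℤ := ![1, 2, 2, 2, 2, 2, 2]

variable {p q s : ℕ}

lemma prod_radicandSupport (i : Fin 7) :
    ∏ j ∈ radicandSupport i, basePrime p q s j = radicand p q s i := by
  fin_cases i <;> simp [radicandSupport, basePrime, radicand, mul_assoc]

lemma prod_factorSupport (i : Fin 7) :
    ∏ j ∈ factorSupport i, basePrime p q s j = unitFactor p s i := by
  fin_cases i <;> simp [factorSupport, basePrime, unitFactor]

lemma prod_sign_radicandSupport (v : Fin 4 → ℤˣ) (i : Fin 7) :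
    ∏ j ∈ radicandSupport i, v j = radicandSign v i := by
  fin_cases i <;> simp [radicandSupport, radicandSign, mul_assoc]

lemma prod_sign_factorSupport (v : Fin 4 → ℤˣ) (i : Fin 7) :
    ∏ j ∈ factorSupport i, v j = factorSign v i := by
  fin_cases i <;> simp [factorSupport, factorSign]

namespace IsResidueTriple

variable (h : IsResidueTriple p q s)

include h

lemma prime_basePrime (j : Fin 4) : (basePrime p q s j).Prime := by
  fin_cases j
  exacts [Nat.prime_two, h.prime_p, h.prime_q, h.prime_s]

lemma basePrime_injective : Function.Injective (basePrime p q s) := by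
  have hp8 := h.p_mod
  have hq8 := h.q_mod
  have hs8 := h.s_mod
  intro i j hij
  fin_cases i <;> fin_cases j <;> simp [basePrime] at hij ⊢ <;> omega

/-- The automorphism of the ambient field acting by the signs `v` on the generators. -/
def aut (v : Fin 4 → ℤˣ) : ambientField p q s ≃ₐ[ℚ] ambientField p q s :=
  signAut h.prime_basePrime h.basePrime_injective v

lemma squarefree_prod_basePrime (T : Finset (Fin 4)) :
    Squarefree (∏ j ∈ T, basePrime p q s j) := by
  refine Finset.squarefree_prod_of_pairwise_isCoprime ?_ fun j _ => (h.prime_basePrime j).squarefree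
  intro i _ j _ hij
  exact Nat.coprime_iff_isRelPrime.1 ((Nat.coprime_primes (h.prime_basePrime i)
    (h.prime_basePrime j)).2 fun hb => hij (h.basePrime_injective hb))

lemma exists_unit_root_two : ∃ η : ambientField p q s, 1 < η ∧
    (∀ v, h.aut v η = (((v 0 : ℤˣ) : ℤ) : ambientField p q s) * η ^ ((v 0 : ℤˣ) : ℤ)) ∧
    ∀ u : ℝˣ, u ∈ integralUnits (adjoin ℚ {√((2 : ℕ) : ℝ)}) ↔
      ∃ k : ℤ, (u : ℝ) = (η : ℝ) ^ k ∨ (u : ℝ) = -(η : ℝ) ^ k := by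
  obtain ⟨ε, hε, hε1, hgen⟩ := exists_fundamental_unit (d := 2) Nat.prime_two.prime.not_isSquare
  obtain ⟨t, y, n, h1, h2⟩ := exists_trace_norm Nat.prime_two.prime.not_isSquare hε
  set r := root (basePrime p q s) 0 with hr
  have hr2 : r ^ 2 = 2 := by
    rw [hr, root_sq]
    norm_num [basePrime]
  have hrR : (r : ℝ) = √((2 : ℕ) : ℝ) := rfl
  let η : ambientField p q s := (t + y * r) / 2
  have hηR : (η : ℝ) = ε := by
    have : (η : ℝ) = (t + y * √((2 : ℕ) : ℝ)) / 2 := by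
      rw [← hrR]
      simp [η, coe_ofNat]
    rw [this, ← h1]
    ring
  have hη1 : 1 < η := by
    change (1 : ℝ) < (η : ℝ)
    rwa [hηR]
  have hη0 : η ≠ 0 := (zero_lt_one.trans hη1).ne'
  have hgr : ∀ v, h.aut v r = (((v 0 : ℤˣ) : ℤ) : ambientField p q s) * r := fun v =>
    signAut_root _ _ v 0
  have hgη : ∀ v, h.aut v η = (t + y * ((((v 0 : ℤˣ) : ℤ) : ambientField p q s) * r)) / 2 := by
    intro v
    simp only [η, map_div₀, map_add, map_mul, map_intCast, map_ratCast, hgr, map_ofNat]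
  have h2M : (t : ambientField p q s) ^ 2 - 2 * y ^ 2 = 4 * ((n : ℤ) : ambientField p q s) := by
    have := congrArg (Rat.cast : ℚ → ambientField p q s) h2
    push_cast at this
    exact this
  have hnorm : ∀ v : Fin 4 → ℤˣ, v 0 = -1 → η * h.aut v η = ((n : ℤ) : ambientField p q s) := by
    intro v hv
    rw [hgη v, hv]
    simp only [η, Units.val_neg, Units.val_one, Int.cast_neg, Int.cast_one]
    linear_combination h2M / 4 - (y : ambientField p q s) ^ 2 / 4 * hr2
  have hn : n = -1 := by
    refine (Int.units_eq_one_or n).resolve_left ?_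
    rintro rfl
    have hrpos : (0 : ℝ) < r := Real.sqrt_pos.2 (by norm_num [basePrime])
    have hr2R : (r : ℝ) ^ 2 = 2 := by
      rw [hrR, Real.sq_sqrt (Nat.cast_nonneg _), Nat.cast_ofNat]
    obtain ⟨k, hk⟩ := hgen (Units.mk0 (1 + (r : ℝ)) (by positivity))
      (mem_integralUnits_of_trace_norm (t := 2) (y := 2) (n := -1)
        (by rw [Units.val_mk0, hrR]; push_cast; ring) (by norm_num))
    have hk' : 1 + r = η ^ k ∨ 1 + r = -η ^ k := by
      refine hk.imp (fun h => Subtype.ext ?_) fun h => Subtype.ext ?_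
      · have := congrArg Units.val h
        rw [Units.val_mk0, Units.val_zpow_eq_zpow_val, ← hηR] at this
        simpa [coe_zpow] using this
      · have := congrArg Units.val h
        rw [Units.val_mk0, Units.val_neg, Units.val_zpow_eq_zpow_val, ← hηR] at this
        simpa [coe_zpow] using this
    have hg := hnorm ![-1, 1, 1, 1] rfl
    have hprod : (1 + r) * h.aut ![-1, 1, 1, 1] (1 + r) = 1 := by
      rcases hk' with hk | hk
      · rw [hk, map_zpow₀, ← mul_zpow, hg]
        simp
      · rw [hk, map_neg, map_zpow₀, neg_mul_neg, ← mul_zpow, hg]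
        simp
    rw [map_add, map_one, hgr] at hprod
    simp only [Matrix.cons_val_zero, Units.val_neg, Units.val_one, Int.cast_neg,
      Int.cast_one] at hprod
    have : (-1 : ambientField p q s) = 1 := by linear_combination hprod + hr2
    norm_num at this
  refine ⟨η, hη1, fun v => ?_, fun u => ?_⟩
  · rcases Int.units_eq_one_or (v 0) with hv | hv
    · rw [hgη, hv]
      simp [η]
    · have := hnorm v hv
      rw [hn] at this
      rw [hv]
      simp only [Units.val_neg, Units.val_one, Int.cast_neg, Int.cast_one, zpow_neg,
        zpow_one] at this ⊢
      field_simp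
      linear_combination this
  · rw [hηR]
    constructor
    · intro hu
      obtain ⟨k, hk⟩ := hgen u hu
      refine ⟨k, hk.imp (fun h => ?_) fun h => ?_⟩
      · rw [h, Units.val_zpow_eq_zpow_val]
      · rw [h, Units.val_neg, Units.val_zpow_eq_zpow_val]
    · rintro ⟨k, hk⟩
      have h3 : u = ε ^ k ∨ u = -ε ^ k := by
        refine hk.imp (fun h => Units.ext ?_) fun h => Units.ext ?_
        · rw [h, Units.val_zpow_eq_zpow_val]
        · rw [h, Units.val_neg, Units.val_zpow_eq_zpow_val]
      rcases h3 with rfl | rfl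
      · exact zpow_mem hε k
      · exact neg_mem_integralUnits (zpow_mem hε k)

lemma exists_unit_root_succ (i : Fin 6) : ∃ η : ambientField p q s, 1 < η ∧
    (∀ v, h.aut v η = ((factorSign v i.succ : ℤ) : ambientField p q s) *
      η ^ (radicandSign v i.succ : ℤ)) ∧
    ∀ u : ℝˣ, u ∈ integralUnits (adjoin ℚ {√(radicand p q s i.succ : ℝ)}) ↔
      ∃ k : ℤ, (u : ℝ) = ((η : ℝ) ^ 2) ^ k ∨ (u : ℝ) = -((η : ℝ) ^ 2) ^ k := by
  obtain ⟨r, hr, hr4, hrd⟩ : ∃ r : ℕ, r.Prime ∧ r % 4 = 3 ∧ r ∣ radicand p q s i.succ := by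
    have hq4 : q % 4 = 3 := by have := h.q_mod; omega
    have hs4 : s % 4 = 3 := by have := h.s_mod; omega
    fin_cases i
    · exact ⟨q, h.prime_q, hq4, dvd_mul_left q _⟩
    · exact ⟨s, h.prime_s, hs4, dvd_mul_left s _⟩
    · exact ⟨s, h.prime_s, hs4, dvd_mul_left s _⟩
    · exact ⟨q, h.prime_q, hq4, dvd_mul_left q _⟩
    · exact ⟨s, h.prime_s, hs4, dvd_mul_left s _⟩
    · exact ⟨s, h.prime_s, hs4, dvd_mul_left s _⟩
  have hsf : Squarefree (radicand p q s i.succ) := by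
    rw [← prod_radicandSupport]
    exact h.squarefree_prod_basePrime _
  obtain ⟨x, z, t, y, hx1, hz, hxz, hxt, hty, hgen⟩ := exists_sqrt_fundamental_unit hsf hr hr4 hrd
    fun m₀ z w hm heq h1 hd => h.unitFactor_eq i hm heq h1 hd
  set a := rootProd (basePrime p q s) (radicandSupport i.succ) with ha
  set b := rootProd (basePrime p q s) (factorSupport i.succ) with hb
  have haR : (a : ℝ) = √(radicand p q s i.succ : ℝ) := by
    rw [ha, coe_rootProd, prod_radicandSupport]
  have hbR : (b : ℝ) = √(unitFactor p s i.succ : ℝ) := by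
    rw [hb, coe_rootProd, prod_factorSupport]
  have ha2 : a ^ 2 = radicand p q s i.succ := by
    rw [ha, rootProd_sq, prod_radicandSupport, Rat.cast_natCast]
  have hb0 : b ≠ 0 := (rootProd_pos h.prime_basePrime _).ne'
  have hz0 : (z : ambientField p q s) ≠ 0 := by exact_mod_cast hz
  let ε : ambientField p q s := (t + y * a) / 2
  let η : ambientField p q s := (1 + ε) / (z * b)
  have hεR : (ε : ℝ) = x ^ 2 := by
    have : (ε : ℝ) = (t + y * √(radicand p q s i.succ : ℝ)) / 2 := by
      rw [← haR]
      simp [ε, coe_ofNat]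
    rw [this, ← hxt]
    ring
  have hηR : (η : ℝ) = x := by
    have h0 : (z : ℝ) * √(unitFactor p s i.succ : ℝ) ≠ 0 := by
      intro h0
      rw [h0] at hxz
      nlinarith
    have : (η : ℝ) = (1 + (ε : ℝ)) / (z * √(unitFactor p s i.succ : ℝ)) := by
      rw [← hbR]
      simp [η]
    rw [this, hεR, div_eq_iff h0, hxz]
  have hη1 : 1 < η := by
    change (1 : ℝ) < (η : ℝ)
    rwa [hηR]
  have hη0 : η ≠ 0 := (zero_lt_one.trans hη1).ne'
  have hη2 : ε = η ^ 2 := Subtype.ext (by rw [hεR]; push_cast; rw [hηR])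
  have htyM : (t : ambientField p q s) ^ 2 - radicand p q s i.succ * y ^ 2 = 4 := by
    exact_mod_cast congrArg (Int.cast : ℤ → ambientField p q s) hty
  have hsign : ∀ n : ℤˣ, ((n : ℤ) : ambientField p q s)⁻¹ = ((n : ℤ) : ambientField p q s) := by
    intro n
    rcases Int.units_eq_one_or n with rfl | rfl <;> simp
  have hgη : ∀ v, h.aut v η =
      (factorSign v i.succ : ℤ) * ((1 + h.aut v ε) / (z * b)) := by
    intro v
    have hgb : h.aut v b = _ := signAut_rootProd _ _ v _
    rw [prod_sign_factorSupport, ← hb] at hgb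
    simp only [η, map_div₀, map_add, map_mul, map_natCast, hgb, map_one]
    rw [mul_left_comm, div_mul_eq_div_mul_one_div,
      div_eq_mul_inv _ (((_ : ℤ) : ambientField p q s)), hsign]
    ring
  refine ⟨η, hη1, fun v => ?_, by simpa only [hηR] using hgen⟩
  rw [hgη]
  congr 1
  have hga : h.aut v a = _ := signAut_rootProd _ _ v _
  rw [prod_sign_radicandSupport, ← ha] at hga
  rcases Int.units_eq_one_or (radicandSign v i.succ) with hv | hv
  · have : h.aut v ε = ε := by
      simp only [ε, map_div₀, map_add, map_mul, map_intCast, map_ofNat, hga, hv]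
      simp
    rw [this, hv]
    simp [η]
  · have hgε : ε * h.aut v ε = 1 := by
      simp only [ε, map_div₀, map_add, map_mul, map_intCast, map_ofNat, hga, hv]
      simp only [Units.val_neg, Units.val_one, Int.cast_neg, Int.cast_one]
      linear_combination htyM / 4 - (y : ambientField p q s) ^ 2 / 4 * ha2
    have hη2' : h.aut v ε = (η ^ 2)⁻¹ := by
      rw [← hη2]
      exact eq_inv_of_mul_eq_one_right hgε
    have h3 : η * (z * b) = 1 + η ^ 2 := by
      rw [← hη2]
      exact div_mul_cancel₀ _ (mul_ne_zero hz0 hb0)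
    rw [hη2', hv, div_eq_iff (mul_ne_zero hz0 hb0)]
    simp only [Units.val_neg, Units.val_one, zpow_neg, zpow_one]
    field_simp
    linear_combination -h3

/-- The system of units `η i`: `η 0` is the fundamental unit of `ℚ(√2)`, the others are square
roots of the fundamental units of the remaining six quadratic fields. -/
theorem exists_unit_roots : ∃ η : Fin 7 → ambientField p q s, (∀ i, 1 < η i) ∧
    ActsBySigns (fun v => (h.aut v : ambientField p q s ≃+* ambientField p q s)) η ∧
    ∀ i, ∀ u : ℝˣ, u ∈ integralUnits (adjoin ℚ {√(radicand p q s i : ℝ)}) ↔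
      ∃ k : ℤ, (u : ℝ) = (η i : ℝ) ^ (unitExponent i * k) ∨
        (u : ℝ) = -(η i : ℝ) ^ (unitExponent i * k) := by
  have key : ∀ i : Fin 7, ∃ η : ambientField p q s, 1 < η ∧
    (∀ v, h.aut v η = ((factorSign v i : ℤ) : ambientField p q s) * η ^ (radicandSign v i : ℤ)) ∧
    ∀ u : ℝˣ, u ∈ integralUnits (adjoin ℚ {√(radicand p q s i : ℝ)}) ↔
      ∃ k : ℤ, (u : ℝ) = (η : ℝ) ^ (unitExponent i * k) ∨
        (u : ℝ) = -(η : ℝ) ^ (unitExponent i * k) := by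
    intro i
    cases i using Fin.cases with
    | zero =>
      obtain ⟨η, h1, h2, h3⟩ := h.exists_unit_root_two
      refine ⟨η, h1, h2, fun u => ?_⟩
      have hi : unitExponent 0 = 1 := rfl
      simp only [hi, one_mul]
      exact h3 u
    | succ i =>
      obtain ⟨η, h1, h2, h3⟩ := h.exists_unit_root_succ i
      have hi : unitExponent i.succ = 2 := by fin_cases i <;> rfl
      refine ⟨η, h1, h2, fun u => ?_⟩
      simp only [hi, zpow_mul]
      exact h3 u
  choose η h1 h2 h3 using key
  exact ⟨η, h1, fun v i => h2 i v, h3⟩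

end IsResidueTriple

end UnitRoots

section FixedElements

variable {ι : Type*} [Fintype ι] [DecidableEq ι] {ℓ : ι → ℕ} (hℓ : ∀ j, (ℓ j).Prime)
  (hinj : Function.Injective ℓ)

lemma signAut_one (x : radicalField ℓ Set.univ) : signAut hℓ hinj 1 x = x :=
  signAut_eq_self_of_mem hℓ hinj 1 (fun _ _ => rfl) x x.2

lemma exists_rat_of_fixed {x : radicalField ℓ Set.univ} (hx : ∀ v, signAut hℓ hinj v x = x) :
    ∃ r : ℚ, x = r := by
  have key : ∀ T : Finset ι, (x : ℝ) ∈ radicalField ℓ T → ∃ r : ℚ, x = r := by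
    intro T
    induction T using Finset.induction_on with
    | empty =>
      intro h
      simp only [radicalField, Finset.coe_empty, Set.image_empty, adjoin_empty, mem_bot] at h
      obtain ⟨r, hr⟩ := h
      exact ⟨r, Subtype.ext (by simpa using hr.symm)⟩
    | insert j T hj ih =>
      intro h
      rw [radicalField, Finset.coe_insert, Set.image_insert_eq] at h
      refine ih (mem_adjoin_of_fixed (a := root ℓ j) ?_ ?_ (sqrt_sq_mem _ _)
        (signAut hℓ hinj (Function.update 1 j (-1))) ?_ ?_ h (hx _))
      · rintro _ ⟨i, -, rfl⟩
        exact isAlgebraic_sqrt _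
      · rintro _ ⟨i, -, rfl⟩
        exact (root ℓ i).2
      · rintro y ⟨i, hi, hy⟩
        obtain rfl : root ℓ i = y := Subtype.ext hy
        have : i ≠ j := fun h => hj (h ▸ hi)
        simp [signAut_root, this]
      · simp [signAut_root]
  exact key Finset.univ (by simp)

/-- The projection of `x` to the eigenspace of `∏ j ∈ T, √(ℓ j)`, multiplied by the degree. -/
def charSum (T : Finset ι) (x : radicalField ℓ Set.univ) : radicalField ℓ Set.univ :=
  ∑ v : ι → ℤˣ, (((∏ j ∈ T, v j : ℤˣ) : ℤ) : radicalField ℓ Set.univ) * signAut hℓ hinj v x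

lemma signAut_charSum (T : Finset ι) (x : radicalField ℓ Set.univ) (v : ι → ℤˣ) :
    signAut hℓ hinj v (charSum hℓ hinj T x) =
      (((∏ j ∈ T, v j : ℤˣ) : ℤ) : radicalField ℓ Set.univ) * charSum hℓ hinj T x := by
  simp only [charSum, map_sum, map_mul, map_intCast, signAut_mul, Finset.mul_sum]
  refine Fintype.sum_equiv (Equiv.mulLeft v) _ _ fun w => ?_
  have : (∏ j ∈ T, w j : ℤˣ) = (∏ j ∈ T, v j) * ∏ j ∈ T, (v * w) j := by
    rw [← Finset.prod_mul_distrib]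
    refine Finset.prod_congr rfl fun j _ => ?_
    rw [Pi.mul_apply, ← mul_assoc, Int.units_mul_self, one_mul]
  rw [this, Units.val_mul, Int.cast_mul, mul_assoc]
  rfl

lemma charSum_signAut (T : Finset ι) (x : radicalField ℓ Set.univ) (v : ι → ℤˣ) :
    charSum hℓ hinj T (signAut hℓ hinj v x) = signAut hℓ hinj v (charSum hℓ hinj T x) := by
  simp only [charSum, map_sum, map_mul, map_intCast, signAut_comm hℓ hinj v]

lemma sum_charSum (x : radicalField ℓ Set.univ) :
    ∑ T, charSum hℓ hinj T x = 2 ^ Fintype.card ι * x := by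
  simp only [charSum]
  rw [Finset.sum_comm]
  have h : ∀ v : ι → ℤˣ, ∑ T : Finset ι, (((∏ j ∈ T, v j : ℤˣ) : ℤ) : radicalField ℓ Set.univ) =
      ∏ j, (1 + (((v j : ℤˣ) : ℤ) : radicalField ℓ Set.univ)) := fun v => by
    rw [Finset.prod_one_add, Finset.powerset_univ]
    simp only [Units.coe_prod, Int.cast_prod]
  simp only [← Finset.sum_mul, h]
  rw [Finset.sum_eq_single 1 _ (by simp), signAut_one]
  · norm_num
  · intro v _ hv
    obtain ⟨j, hj⟩ := Function.ne_iff.1 hv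
    rw [Finset.prod_eq_zero (Finset.mem_univ j), zero_mul]
    rw [(Int.units_eq_one_or (v j)).resolve_left hj]
    simp

lemma exists_charSum_mul_rootProd_eq (T : Finset ι) (x : radicalField ℓ Set.univ) :
    ∃ r : ℚ, charSum hℓ hinj T x * rootProd ℓ T = r := by
  refine exists_rat_of_fixed hℓ hinj fun v => ?_
  rw [map_mul, signAut_charSum, signAut_rootProd, mul_mul_mul_comm, ← Int.cast_mul, ← Units.val_mul,
    Int.units_mul_self]
  simp

/-- An element fixed by the automorphisms with signs in `V` lies in any field containing the
square roots fixed by those automorphisms. -/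
lemma mem_of_fixed (V : Set (ι → ℤˣ)) {F : IntermediateField ℚ ℝ}
    (hF : ∀ T : Finset ι, (∀ v ∈ V, ∏ j ∈ T, v j = 1) → √((∏ j ∈ T, ℓ j : ℕ) : ℝ) ∈ F)
    {x : radicalField ℓ Set.univ} (hx : ∀ v ∈ V, signAut hℓ hinj v x = x) : (x : ℝ) ∈ F := by
  have hT : ∀ T, (charSum hℓ hinj T x : ℝ) ∈ F := by
    intro T
    by_cases h : ∀ v ∈ V, ∏ j ∈ T, v j = 1
    · obtain ⟨r, hr⟩ := exists_charSum_mul_rootProd_eq hℓ hinj T x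
      rw [← eq_div_iff (rootProd_pos hℓ T).ne'] at hr
      rw [hr, IntermediateField.coe_div, coe_rootProd]
      exact div_mem (by simp) (hF T h)
    · push Not at h
      obtain ⟨v, hv, hne⟩ := h
      have h1 := signAut_charSum hℓ hinj T x v
      rw [← charSum_signAut, hx v hv, (Int.units_eq_one_or _).resolve_left hne] at h1
      have h2 : charSum hℓ hinj T x = 0 := by
        simp only [Units.val_neg, Units.val_one, Int.cast_neg, Int.cast_one] at h1
        linear_combination h1 / 2
      rw [h2]
      exact zero_mem F
  have hsum : (x : ℝ) = (∑ T, (charSum hℓ hinj T x : ℝ)) / 2 ^ Fintype.card ι := by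
    have := congrArg (algebraMap (radicalField ℓ Set.univ) ℝ) (sum_charSum hℓ hinj x)
    rw [map_sum, map_mul, map_pow, map_ofNat] at this
    rw [eq_div_iff (by positivity)]
    exact (mul_comm _ _).trans this.symm
  rw [hsum]
  exact div_mem (sum_mem fun T _ => hT T) (pow_mem (ofNat_mem _ 2) _)

include hℓ hinj in
omit [DecidableEq ι] in
lemma exists_prod_eq_of_squarefree {n : ℕ} (hn : Squarefree n)
    (h : ∀ r, r.Prime → r ∣ n → ∃ j, r = ℓ j) : ∃ T : Finset ι, n = ∏ j ∈ T, ℓ j := by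
  refine ⟨Finset.univ.filter fun j => ℓ j ∣ n, ?_⟩
  rw [← Finset.prod_image (f := fun r => r) hinj.injOn]
  refine (Nat.prod_primeFactors_of_squarefree hn).symm.trans (Finset.prod_congr ?_ fun _ _ => rfl)
  ext r
  simp only [Nat.mem_primeFactors, Finset.mem_image, Finset.mem_filter, Finset.mem_univ, true_and]
  constructor
  · rintro ⟨hr, hrn, -⟩
    obtain ⟨j, rfl⟩ := h r hr hrn
    exact ⟨j, hrn, rfl⟩
  · rintro ⟨j, hj, rfl⟩
    exact ⟨hℓ j, hj, hn.ne_zero⟩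

include hℓ hinj in
/-- A prime dividing a squarefree number which is a unit times a square in the multiquadratic
field is ramified. -/
lemma exists_eq_of_prime_dvd {j₀ : ι} (hj₀ : ℓ j₀ = 2) {n : ℕ} (hn : Squarefree n)
    {w e : radicalField ℓ Set.univ} (he0 : e ≠ 0) (he : IsIntegral ℤ e) (he' : IsIntegral ℤ e⁻¹)
    (hw : w ^ 2 = n * e) {r : ℕ} (hr : r.Prime) (hrn : r ∣ n) : ∃ j, r = ℓ j := by
  by_contra! hne
  obtain ⟨m, rfl⟩ := hrn
  have hr0 : (r : ℝ) ≠ 0 := by exact_mod_cast hr.ne_zero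
  have hsr : √(r : ℝ) ^ 2 = r := Real.sq_sqrt (Nat.cast_nonneg r)
  have hsr0 : √(r : ℝ) ≠ 0 := by positivity
  have hcoe : ∀ x : radicalField ℓ Set.univ, IsIntegral ℤ x → IsIntegral ℤ (x : ℝ) := fun x hx =>
    map_isIntegral_int (algebraMap (radicalField ℓ Set.univ) ℝ) hx
  have hconj : ∀ v, IsIntegral ℤ ((signAut hℓ hinj v w : ℝ) / √(r : ℝ)) := by
    intro v
    refine IsIntegral.of_pow two_pos ?_
    have h1 : ((signAut hℓ hinj v w : ℝ)) ^ 2 = (r * m : ℕ) * (signAut hℓ hinj v e : ℝ) := by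
      have := congrArg (fun x => ((signAut hℓ hinj v x : radicalField ℓ Set.univ) : ℝ)) hw
      simp only [map_pow, map_mul, map_natCast] at this
      exact this
    have h2 : ((signAut hℓ hinj v w : ℝ) / √(r : ℝ)) ^ 2 = m * (signAut hℓ hinj v e : ℝ) := by
      rw [div_pow, h1, hsr]
      push_cast
      field_simp
    rw [h2]
    exact (isIntegral_natCast _).mul (hcoe _ (map_isIntegral_int (signAut hℓ hinj v) he))
  have hchar : ∀ T, IsIntegral ℤ ((charSum hℓ hinj T w : ℝ) / √(r : ℝ)) := by
    intro T
    have : (charSum hℓ hinj T w : ℝ) / √(r : ℝ) =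
        ∑ v : ι → ℤˣ, (((∏ j ∈ T, v j : ℤˣ) : ℤ) : ℝ) * ((signAut hℓ hinj v w : ℝ) / √(r : ℝ)) := by
      have h1 := map_sum (algebraMap (radicalField ℓ Set.univ) ℝ)
        (fun v : ι → ℤˣ => (((∏ j ∈ T, v j : ℤˣ) : ℤ) : radicalField ℓ Set.univ) *
          signAut hℓ hinj v w) Finset.univ
      refine (congrArg (· / √(r : ℝ)) h1).trans ?_
      rw [Finset.sum_div]
      refine Finset.sum_congr rfl fun v _ => ?_
      rw [map_mul, map_intCast, mul_div_assoc]
      rfl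
    rw [this]
    exact IsIntegral.sum _ fun v _ => (isIntegral_intCast _).mul (hconj v)
  have hroot : ∀ T : Finset ι, IsIntegral ℤ (rootProd ℓ T : ℝ) := by
    intro T
    refine IsIntegral.of_pow two_pos ?_
    rw [coe_rootProd, Real.sq_sqrt (Nat.cast_nonneg _)]
    exact isIntegral_natCast _
  have hP : ∀ T : Finset ι, IsIntegral ℤ ((∏ j, ℓ j : ℕ) * (charSum hℓ hinj T w : ℝ) / r) := by
    intro T
    obtain ⟨x, hx⟩ := exists_charSum_mul_rootProd_eq hℓ hinj T w
    have hxR : (charSum hℓ hinj T w : ℝ) * (rootProd ℓ T : ℝ) = x := by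
      have := congrArg Subtype.val hx
      simpa using this
    have h1 : IsIntegral ℤ ((x ^ 2 / r : ℚ) : ℝ) := by
      have : ((x ^ 2 / r : ℚ) : ℝ) =
          ((charSum hℓ hinj T w : ℝ) / √(r : ℝ) * (rootProd ℓ T : ℝ)) ^ 2 := by
        push_cast
        rw [← hxR, mul_pow, mul_pow, div_pow, hsr]
        ring
      rw [this]
      exact ((hchar T).mul (hroot T)).pow 2
    obtain ⟨k, hk⟩ := exists_int_of_isIntegral_ratCast h1
    rw [div_eq_iff (by exact_mod_cast hr.ne_zero)] at hk
    obtain ⟨y, rfl⟩ := exists_int_of_isIntegral_ratCast (K := ℝ) (r := x) (by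
      refine IsIntegral.of_pow two_pos ?_
      have : ((x : ℝ)) ^ 2 = ((k * r : ℤ) : ℝ) := by exact_mod_cast congrArg (Rat.cast : ℚ → ℝ) hk
      rw [this]
      exact isIntegral_intCast _)
    have hk' : y ^ 2 = k * r := by exact_mod_cast hk
    obtain ⟨z, rfl⟩ : (r : ℤ) ∣ y :=
      (Nat.prime_iff_prime_int.1 hr).dvd_of_dvd_pow (hk' ▸ dvd_mul_left _ _)
    obtain ⟨P, hP⟩ := Finset.prod_dvd_prod_of_subset T Finset.univ ℓ (Finset.subset_univ T)
    have : ((∏ j, ℓ j : ℕ) : ℝ) * (charSum hℓ hinj T w : ℝ) / r = P * z * (rootProd ℓ T : ℝ) := by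
      have h2 : (rootProd ℓ T : ℝ) ^ 2 = (∏ j ∈ T, ℓ j : ℕ) := by
        rw [coe_rootProd, Real.sq_sqrt (Nat.cast_nonneg _)]
      rw [hP, Nat.cast_mul, ← h2, div_eq_iff hr0]
      push_cast at hxR
      linear_combination P * (rootProd ℓ T : ℝ) * hxR
    rw [this]
    exact ((isIntegral_natCast _).mul (isIntegral_intCast _)).mul (hroot T)
  set D : ℕ := (∏ j, ℓ j) * 2 ^ Fintype.card ι with hD
  have hDw : IsIntegral ℤ (D * (w : ℝ) / r) := by
    have h1 := congrArg (algebraMap (radicalField ℓ Set.univ) ℝ) (sum_charSum hℓ hinj w)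
    rw [map_sum, map_mul, map_pow, map_ofNat] at h1
    have : D * (w : ℝ) / r = ∑ T, (∏ j, ℓ j : ℕ) * (charSum hℓ hinj T w : ℝ) / r := by
      rw [← Finset.sum_div, ← Finset.mul_sum, hD, Nat.cast_mul, mul_assoc, Nat.cast_pow,
        Nat.cast_ofNat]
      exact congrArg (fun x => _ * x / _) h1.symm
    rw [this]
    exact IsIntegral.sum _ fun T _ => hP T
  have hDr : ¬ r ∣ D := by
    intro hrD
    rcases hr.dvd_mul.1 hrD with h | h
    · obtain ⟨j, -, hj⟩ := hr.prime.exists_mem_finset_dvd h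
      exact hne j ((Nat.prime_dvd_prime_iff_eq hr (hℓ j)).1 hj)
    · exact hne j₀ (hj₀.symm ▸ (Nat.prime_dvd_prime_iff_eq hr Nat.prime_two).1
        (hr.dvd_of_dvd_pow h))
  have hfin : IsIntegral ℤ ((D ^ 2 * m / r : ℚ) : ℝ) := by
    have hwR : (w : ℝ) ^ 2 = (r * m) * (e : ℝ) := by
      have := congrArg Subtype.val hw
      simpa using this
    have he0R : (e : ℝ) ≠ 0 := by simpa using he0
    have : ((D ^ 2 * m / r : ℚ) : ℝ) =
        (D * (w : ℝ) / r) ^ 2 * ((e⁻¹ : radicalField ℓ Set.univ) : ℝ) := by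
      rw [div_pow, mul_pow, hwR, IntermediateField.coe_inv]
      push_cast
      field_simp
    rw [this]
    exact (hDw.pow 2).mul (hcoe _ he')
  obtain ⟨k, hk⟩ := exists_int_of_isIntegral_ratCast hfin
  rw [div_eq_iff (by exact_mod_cast hr.ne_zero)] at hk
  have hk' : (D : ℤ) ^ 2 * m = k * r := by exact_mod_cast hk
  have hdvd : r ∣ D ^ 2 * m := by
    have : (r : ℤ) ∣ (D : ℤ) ^ 2 * m := hk' ▸ dvd_mul_left _ _
    exact_mod_cast this
  rcases hr.dvd_mul.1 hdvd with h | h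
  · exact hDr (hr.dvd_of_dvd_pow h)
  · exact hr.not_isUnit (hn r (Nat.mul_dvd_mul_left r h))

end FixedElements

section SquareRootOfProduct

/-- For `y i ≠ 0` the quantity `((y₄y₆-1)(y₁y₃-1) + (y₁+y₃)(y₄+y₆))² / (y₁y₃y₄y₆)` is invariant
under the sign changes and inversions by which the automorphisms act on the units. -/
lemma ActsBySigns.apply_invariant {M : Type*} [Field M] {g : (Fin 4 → ℤˣ) → (M ≃+* M)}
    {η : Fin 7 → M} (h : ActsBySigns g η) (hη : ∀ i, η i ≠ 0) (v : Fin 4 → ℤˣ) :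
    g v (((η 4 * η 6 - 1) * (η 1 * η 3 - 1) + (η 1 + η 3) * (η 4 + η 6)) ^ 2 /
      (η 1 * η 3 * η 4 * η 6)) =
    ((η 4 * η 6 - 1) * (η 1 * η 3 - 1) + (η 1 + η 3) * (η 4 + η 6)) ^ 2 /
      (η 1 * η 3 * η 4 * η 6) := by
  have h1 := hη 1
  have h3 := hη 3
  have h4 := hη 4
  have h6 := hη 6
  simp only [map_div₀, map_pow, map_mul, map_add, map_sub, map_one, h v, factorSign, radicandSign,
    Matrix.cons_val]
  rcases Int.units_eq_one_or (v 0) with e0 | e0 <;>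
  rcases Int.units_eq_one_or (v 1) with e1 | e1 <;>
  rcases Int.units_eq_one_or (v 2) with e2 | e2 <;>
  rcases Int.units_eq_one_or (v 3) with e3 | e3 <;>
  simp only [e0, e1, e2, e3, mul_one, one_mul, mul_neg, neg_neg, Units.val_one, Units.val_neg,
    Int.cast_one, Int.cast_neg, zpow_one, zpow_neg, neg_mul] <;>
  field_simp <;> ring

lemma exists_squarefree_mul_sq {n : ℚ} (hn : 0 < n) :
    ∃ (m : ℕ) (r : ℚ), Squarefree m ∧ 0 < r ∧ n = m * r ^ 2 := by
  have hnum : 0 < n.num := Rat.num_pos.2 hn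
  obtain ⟨m, c, hc⟩ := Nat.sq_mul_squarefree (n.num.toNat * n.den)
  have hpos : n.num.toNat * n.den ≠ 0 := mul_ne_zero (by omega) n.den_nz
  have hc0 : c ≠ 0 := by
    rintro rfl
    exact hpos (by rw [← hc.1]; simp)
  have hden : (n.den : ℚ) ≠ 0 := by exact_mod_cast n.den_nz
  refine ⟨m, c / n.den, hc.2, by positivity, ?_⟩
  have h1 : (c : ℚ) ^ 2 * m = n.num * n.den := by
    have h2 : ((n.num.toNat : ℤ) : ℚ) = n.num := by rw [Int.toNat_of_nonneg hnum.le]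
    have := congrArg (Nat.cast : ℕ → ℚ) hc.1
    push_cast at this h2
    rw [h2] at this
    exact this
  have h3 : n * n.den = n.num := Rat.mul_den_eq_num n
  field_simp
  linear_combination (n.den : ℚ) * h3 - h1

variable {p q s : ℕ} (h : IsResidueTriple p q s)

lemma IsResidueTriple.exists_sq_eq {η : Fin 7 → ambientField p q s} (hη : ∀ i, 1 < η i)
    (hact : ActsBySigns (fun v => (h.aut v : ambientField p q s ≃+* ambientField p q s)) η)
    (hInt : ∀ i, IsIntegral ℤ (η i)) (hInt' : ∀ i, IsIntegral ℤ (η i)⁻¹) :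
    ∃ ρ : ambientField p q s, ρ ^ 2 = η 1 * η 3 * η 4 * η 6 ∧
      (h.aut oddSigns ρ = ρ ∨ h.aut oddSigns ρ = -ρ) := by
  have hpos : ∀ i, 0 < η i := fun i => zero_lt_one.trans (hη i)
  set ξ := η 1 * η 3 * η 4 * η 6 with hξ
  set t := (η 4 * η 6 - 1) * (η 1 * η 3 - 1) + (η 1 + η 3) * (η 4 + η 6) with ht
  have hξ0 : 0 < ξ := by have := hpos 1; have := hpos 3; have := hpos 4; have := hpos 6; positivity
  have ht0 : 0 < t := by
    have h1 : 0 ≤ η 4 * η 6 - 1 := sub_nonneg.2 (one_lt_mul_of_lt_of_le (hη 4) (hη 6).le).le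
    have h2 : 0 ≤ η 1 * η 3 - 1 := sub_nonneg.2 (one_lt_mul_of_lt_of_le (hη 1) (hη 3).le).le
    exact add_pos_of_nonneg_of_pos (mul_nonneg h1 h2)
      (mul_pos (add_pos (hpos 1) (hpos 3)) (add_pos (hpos 4) (hpos 6)))
  obtain ⟨n, hn⟩ : ∃ n : ℚ, t ^ 2 / ξ = n :=
    exists_rat_of_fixed h.prime_basePrime h.basePrime_injective fun v =>
      hact.apply_invariant (fun i => (hpos i).ne') v
  have hn0 : 0 < n := by
    have : (0 : ambientField p q s) < n := hn ▸ by positivity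
    exact_mod_cast this
  obtain ⟨m, r, hm, hr, rfl⟩ := exists_squarefree_mul_sq hn0
  have hr0 : (r : ambientField p q s) ≠ 0 := by exact_mod_cast hr.ne'
  rw [div_eq_iff hξ0.ne'] at hn
  push_cast at hn
  have hw : (t / r) ^ 2 = m * ξ := by
    rw [div_pow, div_eq_iff (pow_ne_zero 2 hr0), hn]
    ring
  have hξi : IsIntegral ℤ ξ := (((hInt 1).mul (hInt 3)).mul (hInt 4)).mul (hInt 6)
  have hξi' : IsIntegral ℤ ξ⁻¹ := by
    rw [hξ, mul_inv, mul_inv, mul_inv]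
    exact (((hInt' 1).mul (hInt' 3)).mul (hInt' 4)).mul (hInt' 6)
  obtain ⟨T, rfl⟩ := exists_prod_eq_of_squarefree h.prime_basePrime h.basePrime_injective hm
    fun r hr hrm => exists_eq_of_prime_dvd h.prime_basePrime h.basePrime_injective (j₀ := 0) rfl hm
      hξ0.ne' hξi hξi' hw hr hrm
  have hT0 := (rootProd_pos h.prime_basePrime T).ne'
  refine ⟨t / r / rootProd (basePrime p q s) T, ?_, ?_⟩
  · rw [div_pow, hw, rootProd_sq, div_eq_iff]
    · push_cast
      ring
    · rw [← rootProd_sq]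
      exact pow_ne_zero 2 hT0
  · have hgt : h.aut oddSigns t = t := by
      have hact' : ∀ i, h.aut oddSigns (η i) = _ := hact oddSigns
      simp only [ht, map_mul, map_add, map_sub, map_one, hact']
      simp only [factorSign, radicandSign, oddSigns, Matrix.cons_val, mul_one, one_mul, mul_neg,
        neg_neg, Units.val_one, Units.val_neg, Int.cast_one, Int.cast_neg, zpow_one, neg_mul]
      ring
    have hgT : h.aut oddSigns (rootProd (basePrime p q s) T) = _ := signAut_rootProd _ _ oddSigns T
    rw [map_div₀, map_div₀, hgt, map_ratCast, hgT]
    rcases Int.units_eq_one_or (∏ j ∈ T, oddSigns j) with e | e <;> rw [e]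
    · left; simp
    · right; simp [div_neg]

end SquareRootOfProduct

section FourthPowers

lemma radicandSign_mul (v w : Fin 4 → ℤˣ) (i : Fin 7) :
    radicandSign (v * w) i = radicandSign v i * radicandSign w i := by
  simp only [← prod_sign_radicandSupport, Pi.mul_apply, Finset.prod_mul_distrib]

lemma card_radicandSign_eq_one (v : Fin 4 → ℤˣ) (hv : v 3 = 1) :
    (Finset.univ.filter fun i => radicandSign v i = 1).card = if v = 1 then 7 else 3 := by
  revert v
  decide +kernel

lemma eq_empty_or_eq_radicandSupport (i : Fin 7) (T : Finset (Fin 4))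
    (h : ∏ j ∈ T, oddSigns j = 1)
    (hT : ∀ v : Fin 4 → ℤˣ, v 3 = 1 → radicandSign v i = 1 → ∏ j ∈ T, v j = 1) :
    T = ∅ ∨ T = radicandSupport i := by
  revert i T
  decide +kernel

lemma eq_empty_of_prod_eq_one (T : Finset (Fin 4)) (h : ∏ j ∈ T, oddSigns j = 1)
    (hT : ∀ v : Fin 4 → ℤˣ, v 3 = 1 → ∏ j ∈ T, v j = 1) : T = ∅ := by
  revert T
  decide +kernel

variable {p q s : ℕ}

/-- The units of the ring of integers of a subfield of `ℝ`. -/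
def fieldUnits (M : IntermediateField ℚ ℝ) : Subgroup Mˣ where
  carrier := {u | IsIntegral ℤ (u : M) ∧ IsIntegral ℤ ((u⁻¹ : Mˣ) : M)}
  one_mem' := by simp [isIntegral_one]
  mul_mem' := by
    rintro u v ⟨h2, h3⟩ ⟨h5, h6⟩
    refine ⟨h2.mul h5, ?_⟩
    rw [mul_inv]
    exact h3.mul h6
  inv_mem' := by
    rintro u ⟨h2, h3⟩
    exact ⟨h3, by simpa using h2⟩

namespace IsResidueTriple

variable (h : IsResidueTriple p q s)

/-- The action of `aut` on units. -/
def unitAut (v : Fin 4 → ℤˣ) : (ambientField p q s)ˣ →* (ambientField p q s)ˣ :=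
  Units.map (h.aut v : ambientField p q s →* ambientField p q s)

lemma unitAut_mul (v w : Fin 4 → ℤˣ) (u : (ambientField p q s)ˣ) :
    h.unitAut v (h.unitAut w u) = h.unitAut (v * w) u :=
  Units.ext (signAut_mul _ _ v w (u : ambientField p q s))

lemma unitAut_mem {u : (ambientField p q s)ˣ} (hu : u ∈ fieldUnits (ambientField p q s))
    (v : Fin 4 → ℤˣ) : h.unitAut v u ∈ fieldUnits (ambientField p q s) :=
  ⟨map_isIntegral_int (h.aut v) hu.1, by
    rw [← map_inv]; exact map_isIntegral_int (h.aut v) hu.2⟩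

lemma unitAut_prod (A : (Fin 4 → ℤˣ) → Prop) [DecidablePred A] (u : (ambientField p q s)ˣ)
    (w : Fin 4 → ℤˣ) (hw : ∀ v, A (w * v) ↔ A v) :
    h.unitAut w (∏ v with A v, h.unitAut v u) = ∏ v with A v, h.unitAut v u := by
  rw [map_prod]
  refine Finset.prod_equiv (Equiv.mulLeft w) (fun v => ?_) fun v _ => ?_
  · simp [hw]
  · rw [unitAut_mul]
    rfl

/-- The norm of `u` to the quadratic field with index `i`. -/
def quadNorm (i : Fin 7) (u : (ambientField p q s)ˣ) : (ambientField p q s)ˣ :=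
  ∏ v with v 3 = 1 ∧ radicandSign v i = 1, h.unitAut v u

/-- The norm of `u` to `ℚ`. -/
def ratNorm (u : (ambientField p q s)ˣ) : (ambientField p q s)ˣ :=
  ∏ v : Fin 4 → ℤˣ with v 3 = 1, h.unitAut v u

lemma prod_quadNorm (u : (ambientField p q s)ˣ) :
    ∏ i, h.quadNorm i u = u ^ 4 * h.ratNorm u ^ 3 := by
  have h1 : ∀ i, h.quadNorm i u = ∏ v : Fin 4 → ℤˣ with v 3 = 1,
      if radicandSign v i = 1 then h.unitAut v u else 1 := fun i => by
    rw [quadNorm, ← Finset.filter_filter, Finset.prod_filter]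
  have h2 : ∀ v : Fin 4 → ℤˣ, v 3 = 1 → ∏ i, (if radicandSign v i = 1 then h.unitAut v u else 1) =
      (if v = 1 then u ^ 4 else 1) * h.unitAut v u ^ 3 := fun v hv => by
    rw [← Finset.prod_filter, Finset.prod_const, card_radicandSign_eq_one v hv]
    split_ifs with h3
    · have : h.unitAut v u = u := Units.ext (by rw [h3]; exact signAut_one _ _ _)
      rw [this, ← pow_add]
    · rw [one_mul]
  rw [Finset.prod_congr rfl fun i _ => h1 i, Finset.prod_comm,
    Finset.prod_congr rfl fun v hv => h2 v (Finset.mem_filter.1 hv).2, Finset.prod_mul_distrib,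
    Finset.prod_pow, ← ratNorm]
  congr 1
  rw [Finset.prod_ite_eq' _ _ fun _ => u ^ 4]
  simp

variable {u : (ambientField p q s)ˣ} (hu : u ∈ fieldUnits (ambientField p q s))
  (hfix : h.unitAut oddSigns u = u)

include hu hfix

lemma ratNorm_eq : h.ratNorm u = 1 ∨ h.ratNorm u = -1 := by
  have hmem : ((h.ratNorm u : ambientField p q s) : ℝ) ∈ (⊥ : IntermediateField ℚ ℝ) := by
    refine mem_of_fixed h.prime_basePrime h.basePrime_injective (insert oddSigns {v | v 3 = 1})
      (fun T hT => ?_) ?_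
    · rw [eq_empty_of_prod_eq_one T (hT _ (Set.mem_insert _ _))
        fun v hv => hT v (Set.mem_insert_of_mem _ hv)]
      simp [one_mem]
    · rintro v (rfl | hv)
      · refine congrArg Units.val (show h.unitAut oddSigns (h.ratNorm u) = h.ratNorm u from ?_)
        rw [ratNorm, map_prod]
        refine Finset.prod_congr rfl fun w _ => ?_
        rw [unitAut_mul, mul_comm, ← unitAut_mul, hfix]
      · refine congrArg Units.val (h.unitAut_prod (fun v => v 3 = 1) u v fun w => ?_)
        rw [Pi.mul_apply, (hv : v 3 = 1), one_mul]
  have hN : h.ratNorm u ∈ fieldUnits (ambientField p q s) :=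
    prod_mem fun v _ => h.unitAut_mem hu v
  rw [mem_bot] at hmem
  obtain ⟨r, hr⟩ := hmem
  have hr' : (r : ambientField p q s) = h.ratNorm u := Subtype.ext (by simpa using hr)
  have hr0 : r ≠ 0 := by
    rintro rfl
    exact (h.ratNorm u).ne_zero (by rw [← hr', Rat.cast_zero])
  obtain ⟨m, hm⟩ := exists_int_of_isIntegral_ratCast (K := ambientField p q s) (r := r)
    (hr' ▸ hN.1)
  obtain ⟨n, hn⟩ := exists_int_of_isIntegral_ratCast (K := ambientField p q s) (r := r⁻¹) (by
    rw [Rat.cast_inv, hr', ← Units.val_inv_eq_inv_val]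
    exact hN.2)
  have hmn : m * n = 1 := by
    have : (m : ℚ) * n = 1 := by rw [← hm, ← hn, mul_inv_cancel₀ hr0]
    exact_mod_cast this
  rcases Int.eq_one_or_neg_one_of_mul_eq_one hmn with rfl | rfl
  · left
    exact Units.ext (by rw [← hr', hm]; simp)
  · right
    exact Units.ext (by rw [← hr', hm]; simp)

lemma quadNorm_mem (i : Fin 7) : h.quadNorm i u ∈ fieldUnits (ambientField p q s) ∧
    ((h.quadNorm i u : ambientField p q s) : ℝ) ∈ adjoin ℚ {√(radicand p q s i : ℝ)} := by
  refine ⟨prod_mem fun v _ => h.unitAut_mem hu v, ?_⟩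
  refine mem_of_fixed h.prime_basePrime h.basePrime_injective
    (insert oddSigns {v | v 3 = 1 ∧ radicandSign v i = 1}) (fun T hT => ?_) ?_
  · rcases eq_empty_or_eq_radicandSupport i T (hT _ (Set.mem_insert _ _))
      fun v hv hv' => hT v (Set.mem_insert_of_mem _ ⟨hv, hv'⟩) with rfl | rfl
    · simp [one_mem]
    · rw [prod_radicandSupport]
      exact subset_adjoin ℚ _ rfl
  · rintro v (rfl | ⟨hv, hv'⟩)
    · refine congrArg Units.val (show h.unitAut oddSigns (h.quadNorm i u) = h.quadNorm i u from ?_)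
      rw [quadNorm, map_prod]
      refine Finset.prod_congr rfl fun w _ => ?_
      rw [unitAut_mul, mul_comm, ← unitAut_mul, hfix]
    · refine congrArg Units.val (h.unitAut_prod (fun v => v 3 = 1 ∧ radicandSign v i = 1) u v
        fun w => ?_)
      rw [Pi.mul_apply, hv, one_mul, radicandSign_mul, hv', one_mul]

lemma pow_four_eq : u ^ 4 = ∏ i, h.quadNorm i u ∨ u ^ 4 = -∏ i, h.quadNorm i u := by
  rw [prod_quadNorm]
  rcases h.ratNorm_eq hu hfix with e | e <;> rw [e]
  · left; simp
  · right
    rw [Odd.neg_one_pow (by decide)]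
    simp

end IsResidueTriple

end FourthPowers

section UnitsInclusion

variable {E F : IntermediateField ℚ ℝ} (hEF : E ≤ F)

/-- The embedding of the units of `𝓞 E` into `Fˣ` for real fields `E ≤ F`. -/
def unitsInclusion : (𝓞 ↥E)ˣ →* (↥F)ˣ :=
  (Units.map (inclusion hEF : ↥E →* ↥F)).comp
    (Units.map (algebraMap (𝓞 ↥E) ↥E : 𝓞 ↥E →* ↥E))

lemma coe_unitsInclusion (u : (𝓞 ↥E)ˣ) :
    ((unitsInclusion hEF u : ↥F) : ℝ) = (((u : 𝓞 ↥E) : ↥E) : ℝ) := rfl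

lemma unitsInclusion_injective : Function.Injective (unitsInclusion hEF) := by
  intro u v huv
  have := congrArg (fun x : (↥F)ˣ => ((x : ↥F) : ℝ)) huv
  simp only [coe_unitsInclusion] at this
  exact Units.ext (RingOfIntegers.ext (Subtype.ext this))

lemma unitsInclusion_mem_fieldUnits (u : (𝓞 ↥E)ˣ) : unitsInclusion hEF u ∈ fieldUnits F := by
  have : ∀ u : (𝓞 ↥E)ˣ, IsIntegral ℤ (unitsInclusion hEF u : ↥F) :=
    fun u => map_isIntegral_int (inclusion hEF)
      (RingOfIntegers.isIntegral_coe (K := ↥E) (u : 𝓞 ↥E))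
  exact ⟨this u, by rw [← map_inv]; exact this u⁻¹⟩

lemma exists_unitsInclusion_eq {u : (↥F)ˣ} (hu : u ∈ fieldUnits F)
    (huE : ((u : ↥F) : ℝ) ∈ E) : ∃ v, unitsInclusion hEF v = u := by
  have hlift : ∀ v ∈ fieldUnits F, ((v : ↥F) : ℝ) ∈ E →
      ∃ x : 𝓞 ↥E, ((x : ↥E) : ℝ) = ((v : ↥F) : ℝ) := by
    intro v hv hmem
    refine ⟨⟨⟨_, hmem⟩, ?_⟩, rfl⟩
    refine (isIntegral_algebraMap_iff (A := ↥E) (B := ℝ) (algebraMap ↥E ℝ).injective).1 ?_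
    exact map_isIntegral_int (algebraMap ↥F ℝ) hv.1
  obtain ⟨x, hx⟩ := hlift u hu huE
  obtain ⟨y, hy⟩ := hlift u⁻¹ (inv_mem hu) (by simpa using inv_mem huE)
  have hxy : x * y = 1 := by
    refine RingOfIntegers.ext (Subtype.ext ?_)
    have : ((u : ↥F) : ℝ) * (((u⁻¹ : (↥F)ˣ) : ↥F) : ℝ) = 1 := by
      rw [← IntermediateField.coe_mul, Units.mul_inv]
      rfl
    rw [← hx, ← hy] at this
    exact this
  exact ⟨Units.mkOfMulEqOne x y hxy, Units.ext (Subtype.ext hx)⟩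

end UnitsInclusion

section UnitIndex

variable {p q s : ℕ}

/-- The subgroup of the units of the ambient field generated by the units of the quadratic
fields. -/
def quadUnits (p q s : ℕ) : Subgroup (ambientField p q s)ˣ :=
  Subgroup.closure {u | u ∈ fieldUnits (ambientField p q s) ∧
    ∃ i, ((u : ambientField p q s) : ℝ) ∈ adjoin ℚ {√(radicand p q s i : ℝ)}}

lemma mem_integralUnits_map {u : (ambientField p q s)ˣ} {F : IntermediateField ℚ ℝ} :
    Units.map (algebraMap (ambientField p q s) ℝ : ambientField p q s →* ℝ) u ∈ integralUnits F ↔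
      u ∈ fieldUnits (ambientField p q s) ∧ ((u : ambientField p q s) : ℝ) ∈ F := by
  have hInt : ∀ x : ambientField p q s, IsIntegral ℤ (x : ℝ) ↔ IsIntegral ℤ x := fun x =>
    isIntegral_algebraMap_iff (A := ambientField p q s) (B := ℝ)
      (algebraMap (ambientField p q s) ℝ).injective
  rw [mem_integralUnits, ← map_inv]
  exact ⟨fun ⟨h1, h2, h3⟩ => ⟨⟨(hInt _).1 h2, (hInt _).1 h3⟩, h1⟩,
    fun ⟨⟨h2, h3⟩, h1⟩ => ⟨h1, (hInt _).2 h2, (hInt _).2 h3⟩⟩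

lemma sqrt_radicand_mem_ambientField (i : Fin 7) :
    √(radicand p q s i : ℝ) ∈ ambientField p q s := by
  rw [← prod_radicandSupport, ← coe_rootProd]
  exact (rootProd (basePrime p q s) _).2

lemma mem_range_radicand {d : ℕ} :
    d ∈ ({2, p * q, p * s, q * s, 2 * p * q, 2 * p * s, 2 * q * s} : Set ℕ) ↔
      ∃ i, radicand p q s i = d := by
  simp only [Fin.exists_fin_succ, radicand, Set.mem_insert_iff, Set.mem_singleton_iff]
  simp [eq_comm]

namespace IsResidueTriple

variable (h : IsResidueTriple p q s)

/-- The units of the ambient field fixed by the automorphism with signs `oddSigns`. -/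
def fixedUnits : Subgroup (ambientField p q s)ˣ where
  carrier := {u | u ∈ fieldUnits (ambientField p q s) ∧ h.unitAut oddSigns u = u}
  one_mem' := ⟨one_mem _, map_one _⟩
  mul_mem' := fun hu hv => ⟨mul_mem hu.1 hv.1, by rw [map_mul, hu.2, hv.2]⟩
  inv_mem' := fun hu => ⟨inv_mem hu.1, by rw [map_inv, hu.2]⟩

lemma mem_quadUnits_iff {η : Fin 7 → ambientField p q s} (hη : ∀ i, 1 < η i)
    (hgen : ∀ i, ∀ u : ℝˣ, u ∈ integralUnits (adjoin ℚ {√(radicand p q s i : ℝ)}) ↔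
      ∃ k : ℤ, (u : ℝ) = (η i : ℝ) ^ (unitExponent i * k) ∨
        (u : ℝ) = -(η i : ℝ) ^ (unitExponent i * k)) (u : (ambientField p q s)ˣ) :
    u ∈ quadUnits p q s ↔ ∃ b : Fin 7 → ℤ, (∀ i : Fin 6, Even (b i.succ)) ∧
      ((u : ambientField p q s) = monomialZ η b ∨ (u : ambientField p q s) = -monomialZ η b) := by
  have hη0 : ∀ i, η i ≠ 0 := fun i => (zero_lt_one.trans (hη i)).ne'
  have hgenM : ∀ i (u : (ambientField p q s)ˣ), (u ∈ fieldUnits (ambientField p q s) ∧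
      ((u : ambientField p q s) : ℝ) ∈ adjoin ℚ {√(radicand p q s i : ℝ)}) ↔
      ∃ k : ℤ, (u : ambientField p q s) = η i ^ (unitExponent i * k) ∨
        (u : ambientField p q s) = -η i ^ (unitExponent i * k) := by
    intro i u
    rw [← mem_integralUnits_map, hgen]
    refine exists_congr fun k => or_congr ?_ ?_
    · rw [← coe_zpow]
      exact Subtype.ext_iff.symm
    · rw [← coe_zpow, ← IntermediateField.coe_neg]
      exact Subtype.ext_iff.symm
  have hsucc : ∀ i : Fin 6, unitExponent i.succ = 2 := fun i => by fin_cases i <;> rfl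
  rw [← mem_map_signedMonomial η hη0 (fun b => ∀ i : Fin 6, Even (b i.succ)) tailParity.ker
    fun x => mem_ker_tailParity]
  constructor
  · intro hu
    refine (Subgroup.closure_le _).2 ?_ hu
    rintro w ⟨hw, i, hwi⟩
    obtain ⟨k, hk⟩ := (hgenM i w).1 ⟨hw, hwi⟩
    rw [SetLike.mem_coe, mem_map_signedMonomial η hη0 (fun b => ∀ i : Fin 6, Even (b i.succ)) _
      fun x => mem_ker_tailParity]
    refine ⟨Pi.single i (unitExponent i * k), fun j => ?_, ?_⟩
    · rcases eq_or_ne j.succ i with rfl | hne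
      · rw [Pi.single_eq_same, hsucc]
        exact even_two_mul k
      · rw [Pi.single_eq_of_ne hne]
        exact Even.zero
    · have : monomialZ η (Pi.single i (unitExponent i * k)) = η i ^ (unitExponent i * k) := by
        rw [monomialZ, Finset.prod_eq_single i (fun j _ hj => by simp [Pi.single_eq_of_ne hj])
          (by simp), Pi.single_eq_same]
      rwa [this]
  · rw [mem_map_signedMonomial η hη0 (fun b => ∀ i : Fin 6, Even (b i.succ)) _
      fun x => mem_ker_tailParity]
    rintro ⟨b, hb, hub⟩
    have hpow : ∀ i, Units.mk0 (η i) (hη0 i) ^ b i ∈ quadUnits p q s := by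
      intro i
      obtain ⟨k, hk⟩ : ∃ k, b i = unitExponent i * k := by
        cases i using Fin.cases with
        | zero => exact ⟨b 0, (one_mul _).symm⟩
        | succ i =>
          obtain ⟨k, hk⟩ := hb i
          exact ⟨k, by rw [hk, hsucc]; ring⟩
      obtain ⟨h1, h2⟩ := (hgenM i (Units.mk0 (η i) (hη0 i) ^ b i)).2
        ⟨k, Or.inl (by rw [← hk]; simp)⟩
      exact Subgroup.subset_closure ⟨h1, i, h2⟩
    have hneg : (-1 : (ambientField p q s)ˣ) ∈ quadUnits p q s := by
      obtain ⟨h1, h2⟩ := (hgenM 0 (-1)).2 ⟨0, Or.inr (by simp)⟩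
      exact Subgroup.subset_closure ⟨h1, 0, h2⟩
    have hmon :
        ((∏ i, Units.mk0 (η i) (hη0 i) ^ b i : (ambientField p q s)ˣ) : ambientField p q s) =
        monomialZ η b := by
      simp [monomialZ, Units.coe_prod]
    have hprod := prod_mem (t := Finset.univ) fun i _ => hpow i
    rcases hub with e | e
    · rw [show u = _ from Units.ext (e.trans hmon.symm)]
      exact hprod
    · have : u = -1 * ∏ i, Units.mk0 (η i) (hη0 i) ^ b i := Units.ext (by
        rw [Units.val_mul, hmon, e]; simp)
      rw [this]
      exact mul_mem hneg hprod

lemma aut_oddSigns_of_mem {i : Fin 7} {x : ambientField p q s}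
    (hx : (x : ℝ) ∈ adjoin ℚ {√(radicand p q s i : ℝ)}) : h.aut oddSigns x = x := by
  refine apply_eq_self_of_mem_adjoin (S := {√(radicand p q s i : ℝ)})
    (by simpa using sqrt_radicand_mem_ambientField i) _ ?_ x hx
  intro y hy
  obtain rfl : rootProd (basePrime p q s) (radicandSupport i) = y := Subtype.ext (by
    rw [coe_rootProd, prod_radicandSupport]; exact hy.symm)
  refine (signAut_rootProd _ _ oddSigns _).trans ?_
  rw [prod_sign_radicandSupport, show radicandSign oddSigns i = 1 by fin_cases i <;> decide]
  simp

lemma quadUnits_le : quadUnits p q s ≤ h.fixedUnits :=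
  (Subgroup.closure_le _).2 fun _ ⟨h1, _, h2⟩ => ⟨h1, Units.ext (h.aut_oddSigns_of_mem h2)⟩

include h in
theorem relIndex_quadUnits : (quadUnits p q s).relIndex h.fixedUnits = 64 := by
  obtain ⟨η, hη, hact, hgen⟩ := h.exists_unit_roots
  have hη0 : ∀ i, η i ≠ 0 := fun i => (zero_lt_one.trans (hη i)).ne'
  have hunit : ∀ i, Units.mk0 (η i) (hη0 i) ^ 2 ∈ fieldUnits (ambientField p q s) := by
    intro i
    refine (mem_integralUnits_map (F := adjoin ℚ {√(radicand p q s i : ℝ)}).1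
      ((hgen i _).2 ?_)).1
    rcases (show unitExponent i = 1 ∨ unitExponent i = 2 by fin_cases i <;> decide) with e | e
    · exact ⟨2, Or.inl (by rw [e]; simp)⟩
    · exact ⟨1, Or.inl (by rw [e]; simp)⟩
  refine hact.relIndex_eq hη (fun v w x => signAut_comm _ _ v w x)
    (fun u hu => congrArg Units.val hu.2) (fun u hu hu2 => ?_)
    (fun u => mem_quadUnits_iff hη hgen u) h.quadUnits_le (fun u hu => ?_)
    (h.exists_sq_eq hη hact (fun i => IsIntegral.of_pow two_pos (by simpa using (hunit i).1))
      fun i => IsIntegral.of_pow two_pos (by simpa using (hunit i).2))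
  · refine ⟨⟨IsIntegral.of_pow two_pos (by simpa using hu2.1.1),
      IsIntegral.of_pow two_pos (by simpa using hu2.1.2)⟩, Units.ext hu⟩
  · have hN : ∏ i, h.quadNorm i u ∈ quadUnits p q s := prod_mem fun i _ =>
      Subgroup.subset_closure ⟨(h.quadNorm_mem hu.1 hu.2 i).1, i, (h.quadNorm_mem hu.1 hu.2 i).2⟩
    rcases h.pow_four_eq hu.1 hu.2 with e | e <;> rw [e]
    · exact hN
    · rw [← neg_one_mul]
      refine mul_mem (Subgroup.subset_closure ⟨⟨?_, ?_⟩, 0, ?_⟩) hN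
      · simpa using isIntegral_one.neg
      · simpa using isIntegral_one.neg
      · simp [one_mem]

lemma eq_empty_or_exists_eq_radicandSupport (T : Finset (Fin 4)) (hT : ∏ j ∈ T, oddSigns j = 1) :
    T = ∅ ∨ ∃ i, T = radicandSupport i := by
  revert T
  decide +kernel

include h in
lemma sqrt_radicand_mem (i : Fin 7) : √(radicand p q s i : ℝ) ∈ Lplus p q s := by
  have hp : (p : ℝ) ≠ 0 := by exact_mod_cast h.prime_p.ne_zero
  have h2 : √2 ∈ Lplus p q s := subset_adjoin ℚ _ (by simp)
  have hpq : √(p * q) ∈ Lplus p q s := subset_adjoin ℚ _ (by simp)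
  have hps : √(p * s) ∈ Lplus p q s := subset_adjoin ℚ _ (by simp)
  have hqs : √(q * s) ∈ Lplus p q s := by
    have : √(q * s : ℝ) = √(p * q) * √(p * s) / p := by
      rw [eq_div_iff hp, ← Real.sqrt_mul (by positivity),
        show (p * q * (p * s) : ℝ) = q * s * p ^ 2 by ring,
        Real.sqrt_mul (mul_nonneg q.cast_nonneg s.cast_nonneg) (p ^ 2 : ℝ),
        Real.sqrt_sq p.cast_nonneg]
    rw [this]
    exact div_mem (mul_mem hpq hps) (IntermediateField.natCast_mem _ p)
  fin_cases i <;> simp only [radicand, Fin.reduceFinMk, Fin.zero_eta, Fin.mk_one, Matrix.cons_val,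
    Nat.cast_mul, Nat.cast_ofNat, mul_assoc]
  · exact h2
  · exact hpq
  · exact hps
  · exact hqs
  all_goals rw [Real.sqrt_mul (by norm_num)]
  · exact mul_mem h2 hpq
  · exact mul_mem h2 hps
  · exact mul_mem h2 hqs

lemma Lplus_eq_adjoin :
    Lplus p q s = adjoin ℚ ((fun i => √(radicand p q s i : ℝ)) '' {0, 1, 2}) := by
  rw [Lplus]
  congr 1
  simp [Set.image_insert_eq, radicand]

lemma Lplus_le : Lplus p q s ≤ ambientField p q s := by
  rw [Lplus_eq_adjoin, adjoin_le_iff]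
  rintro _ ⟨i, -, rfl⟩
  exact sqrt_radicand_mem_ambientField i

lemma aut_oddSigns_eq_self_iff {x : ambientField p q s} :
    h.aut oddSigns x = x ↔ (x : ℝ) ∈ Lplus p q s := by
  constructor
  · intro hx
    refine mem_of_fixed h.prime_basePrime h.basePrime_injective {oddSigns} (fun T hT => ?_)
      (by rintro _ rfl; exact hx)
    rcases eq_empty_or_exists_eq_radicandSupport T (hT _ rfl) with rfl | ⟨i, rfl⟩
    · simp [one_mem]
    · rw [prod_radicandSupport]
      exact h.sqrt_radicand_mem i
  · intro hx
    rw [Lplus_eq_adjoin] at hx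
    refine apply_eq_self_of_mem_adjoin ?_ _ ?_ x hx
    · rintro _ ⟨i, -, rfl⟩
      exact sqrt_radicand_mem_ambientField i
    · rintro y ⟨i, -, hy⟩
      exact h.aut_oddSigns_of_mem (i := i) (hy ▸ subset_adjoin ℚ _ rfl)

lemma unitsInclusion_Lplus_mem_fixedUnits (u : (𝓞 ↥(Lplus p q s))ˣ) :
    unitsInclusion Lplus_le u ∈ h.fixedUnits := by
  refine ⟨unitsInclusion_mem_fieldUnits _ u, Units.ext (h.aut_oddSigns_eq_self_iff.2 ?_)⟩
  rw [coe_unitsInclusion]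
  exact Subtype.property _

lemma range_unitsInclusion_Lplus :
    (unitsInclusion (Lplus_le (p := p) (q := q) (s := s))).range = h.fixedUnits := by
  ext u
  constructor
  · rintro ⟨u, rfl⟩
    exact h.unitsInclusion_Lplus_mem_fixedUnits u
  · intro hu
    exact exists_unitsInclusion_eq _ hu.1 (h.aut_oddSigns_eq_self_iff.1 (congrArg Units.val hu.2))

include h in
lemma map_quadUnitsSubgroup :
    (quadUnitsSubgroup p q s).map (unitsInclusion Lplus_le) = quadUnits p q s := by
  rw [quadUnitsSubgroup, MonoidHom.map_closure, quadUnits]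
  congr 1
  ext u
  constructor
  · rintro ⟨v, ⟨d, hd, hv⟩, rfl⟩
    obtain ⟨i, rfl⟩ := mem_range_radicand.1 hd
    refine ⟨unitsInclusion_mem_fieldUnits _ v, i, ?_⟩
    rw [coe_unitsInclusion]
    exact hv
  · rintro ⟨hu, i, hi⟩
    obtain ⟨v, rfl⟩ : u ∈ (unitsInclusion (Lplus_le (p := p) (q := q) (s := s))).range := by
      rw [h.range_unitsInclusion_Lplus]
      exact ⟨hu, Units.ext (h.aut_oddSigns_of_mem hi)⟩
    rw [coe_unitsInclusion] at hi
    exact ⟨v, ⟨_, mem_range_radicand.2 ⟨i, rfl⟩, hi⟩, rfl⟩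

include h in
theorem index_quadUnitsSubgroup : (quadUnitsSubgroup p q s).index = 64 := by
  rw [← Subgroup.relIndex_top_right,
    ← Subgroup.relIndex_map_map_of_injective _ _ (unitsInclusion_injective Lplus_le),
    h.map_quadUnitsSubgroup, ← MonoidHom.range_eq_map, h.range_unitsInclusion_Lplus]
  exact h.relIndex_quadUnits

end IsResidueTriple

end UnitIndex

/-- Let `p, q, s` be distinct primes with `p ≡ 5 (mod 8)`, `s ≡ 3 (mod 8)`,
`q ≡ 7 (mod 8)` and `(p/q) = (p/s) = (s/q) = 1`.  Then the subgroup of the unit group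
of the ring of integers of `L⁺ = ℚ(√2, √(pq), √(ps))` generated by the units of its
seven quadratic subfields has index `2⁶ = 64`. -/
theorem statement_10 (p q s : ℕ) (hp : p.Prime) (hq : q.Prime) (hs : s.Prime)
    (hpq : p ≠ q) (hps : p ≠ s) (hqs : q ≠ s)
    (hp8 : p % 8 = 5) (hs8 : s % 8 = 3) (hq8 : q % 8 = 7)
    (hleg1 : @legendreSym q ⟨hq⟩ (p : ℤ) = 1)
    (hleg2 : @legendreSym s ⟨hs⟩ (p : ℤ) = 1)
    (hleg3 : @legendreSym q ⟨hq⟩ (s : ℤ) = 1) :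
    (quadUnitsSubgroup p q s).index = 64 := by
  exact IsResidueTriple.index_quadUnitsSubgroup
    ⟨hp, hq, hs, hp8, hs8, hq8, hleg1, hleg2, hleg3⟩
end
end
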